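/- arXiv:math/0111148 — 3 statements merged into one kernel-verified Lean document; each statement's English description precedes it below -/
import Mathlib

section
/- The Nijenhuis–Richardson bracket makes A(V) = ⊕_{p≥−1} A^p(V) a graded Lie algebra: for alternating A ∈ A^a(V) and B ∈ A^b(V), the insertion i_B A (and hence [A,B]^{NR}) is again alternating, the bracket is graded skew-symmetric, [A,B]^{NR} = −(−1)^{ab}[B,A]^{NR}, and it satisfies the graded Jacobi identity [[A,B]^{NR},C]^{NR} = [A,[B,C]^{NR}]^{NR} − (−1)^{ab}[B,[A,C]^{NR}]^{NR} for all A ∈ A^a(V), B ∈ A^b(V), C ∈ A^c(V). -/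
/-!  Common framework: operations of degree `a ≥ -1` on a vector space `V`
(i.e. `(a+1)`-linear maps `V^{a+1} → V`) are encoded as raw functions
`(ℕ → V) → V` depending only on the first `a+1` entries of the argument
sequence, together with explicit multilinearity/alternation predicates. -/

noncomputable section
open scoped Classical

namespace JacobiRevisited

/-- Raw operations on `V`: an `n`-ary operation is encoded by its action on
infinite sequences of arguments (using only the first `n` of them). -/
abbrev Op (V : Type*) := (ℕ → V) → V

/-- `A` depends only on the first `n` arguments. -/
def DependsOn {V : Type*} (n : ℕ) (A : Op V) : Prop :=
  ∀ x y : ℕ → V, (∀ i, i < n → x i = y i) → A x = A y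

/-- `A` is an `n`-linear map `V^n → V` (encoded on sequences): it depends only on
the first `n` arguments and is `k`-linear in each of them. -/
def IsMultilinearOn (k : Type*) {V : Type*} [Semiring k] [AddCommMonoid V]
    [Module k V] (n : ℕ) (A : Op V) : Prop :=
  DependsOn n A ∧
    ∀ i, i < n →
      (∀ (x : ℕ → V) (c : k) (v : V),
        A (Function.update x i (c • v)) = c • A (Function.update x i v)) ∧
      (∀ (x : ℕ → V) (v w : V),
        A (Function.update x i (v + w)) =
          A (Function.update x i v) + A (Function.update x i w))

/-- `A` is alternating in its first `n` arguments. -/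
def IsAlternatingOn {V : Type*} [Zero V] (n : ℕ) (A : Op V) : Prop :=
  ∀ x : ℕ → V, ∀ i j, i < n → j < n → i ≠ j → x i = x j → A x = 0

/-- The number of arguments of an operation of degree `a` (namely `a+1`). -/
def ar (a : ℤ) : ℕ := (a + 1).toNat

/-- Membership in `M^a(V)`: an `(a+1)`-linear map `V^{a+1} → V`
(for `a = -1` this is just a constant, i.e. an element of `V`). -/
def MemM (k : Type*) {V : Type*} [Semiring k] [AddCommMonoid V] [Module k V]
    (a : ℤ) (A : Op V) : Prop := IsMultilinearOn k (ar a) A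

/-- Membership in `A^a(V)`: an alternating `(a+1)`-linear map `V^{a+1} → V`. -/
def MemA (k : Type*) {V : Type*} [Semiring k] [AddCommMonoid V] [Module k V]
    (a : ℤ) (A : Op V) : Prop :=
  IsMultilinearOn k (ar a) A ∧ IsAlternatingOn (ar a) A

/-- The argument sequence `x_0, …, x_{m-1}, B(x_m,…,x_{m+nB-1}), x_{m+nB}, …`
(arguments for the outer operation after inserting the `nB`-ary `B`
at slot `m`). -/
def insertArg {V : Type*} (B : Op V) (nB m : ℕ) (x : ℕ → V) : ℕ → V := fun j =>
  if j < m then x j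
  else if j = m then B fun i => x (m + i)
  else x (j + nB - 1)

/-- The Gerstenhaber insertion `ι_B A` of `B ∈ M^b(V)` into `A ∈ M^a(V)`:
`ι_B A(x_0,…,x_{a+b}) = Σ_{m=0}^{a} (−1)^{b·m} A(x_0,…,x_{m−1},
B(x_m,…,x_{m+b}), x_{m+b+1},…,x_{a+b})`. -/
def gIns {V : Type*} [AddCommGroup V] (a b : ℤ) (A B : Op V) : Op V := fun x =>
  ∑ m ∈ Finset.range (ar a),
    (((-1 : ℤˣ) ^ (b * (m : ℤ)) : ℤˣ) : ℤ) • A (insertArg B (ar b) m x)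

/-- The Gerstenhaber bracket `[A,B]^G = −ι_A B + (−1)^{ab} ι_B A` of
`A ∈ M^a(V)` and `B ∈ M^b(V)`. -/
def gBracket {V : Type*} [AddCommGroup V] (a b : ℤ) (A B : Op V) : Op V :=
  -(gIns b a B A) + (((-1 : ℤˣ) ^ (a * b) : ℤˣ) : ℤ) • gIns a b A B

/-- The set `S(n-1, p-1)` of unshuffle permutations of `{0,…,n-1}` which are
strictly increasing on the first `p` positions and on the remaining ones. -/
def Unshuffles (n p : ℕ) : Finset (Equiv.Perm (Fin n)) :=
  Finset.univ.filter fun σ =>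
    (∀ i j : Fin n, (i : ℕ) < (j : ℕ) → (j : ℕ) < p → σ i < σ j) ∧
    (∀ i j : Fin n, (i : ℕ) < (j : ℕ) → p ≤ (i : ℕ) → σ i < σ j)

/-- The Nijenhuis–Richardson insertion `i_B A` of the `nB`-ary `B` into the
`nA`-ary `A`:
`i_B A(x_0,…,x_{a+b}) = Σ_{σ ∈ S(a+b,b)} sgn(σ) ·
A(B(x_{σ(0)},…,x_{σ(b)}), x_{σ(b+1)},…,x_{σ(a+b)})`
(and `i_B A = 0` when `A` has degree `-1`, i.e. no argument slots). -/
def nrIns {V : Type*} [AddCommGroup V] (nA nB : ℕ) (A B : Op V) : Op V := fun x =>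
  if hA : nA = 0 then 0
  else
    ∑ σ ∈ Unshuffles (nA + nB - 1) nB,
      ((Equiv.Perm.sign σ : ℤˣ) : ℤ) •
        A fun j =>
          if hj0 : j = 0 then
            B fun i => if hi : i < nB then x (σ ⟨i, by omega⟩) else 0
          else if hj : j < nA then x (σ ⟨nB + j - 1, by omega⟩) else 0

/-- The Nijenhuis–Richardson bracket `[A,B]^{NR} = −i_A B + (−1)^{ab} i_B A`
of `A ∈ A^a(V)` and `B ∈ A^b(V)`. -/
def nrBracket {V : Type*} [AddCommGroup V] (a b : ℤ) (A B : Op V) : Op V :=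
  -(nrIns (ar b) (ar a) B A) +
    (((-1 : ℤˣ) ^ (a * b) : ℤˣ) : ℤ) • nrIns (ar a) (ar b) A B

/-- The wedge product `A∧B` of the `nA`-ary `A` and the `nB`-ary `B`
(over a commutative algebra `V`):
`(A∧B)(x_0,…,x_{a+b+1}) = Σ_σ sgn(σ) · A(x_{σ(0)},…,x_{σ(a)}) ·
B(x_{σ(a+1)},…,x_{σ(a+b+1)})` summed over unshuffles. -/
def wedge {V : Type*} [CommRing V] (nA nB : ℕ) (A B : Op V) : Op V := fun x =>
  ∑ σ ∈ Unshuffles (nA + nB) nA,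
    ((Equiv.Perm.sign σ : ℤˣ) : ℤ) •
      (A (fun i => if hi : i < nA then x (σ ⟨i, by omega⟩) else 0) *
        B fun j => if hj : j < nB then x (σ ⟨nA + j, by omega⟩) else 0)

/-- The argument sequence `v, x_0, x_1, …`. -/
def consV {V : Type*} (v : V) (x : ℕ → V) : ℕ → V := fun n =>
  if n = 0 then v else x (n - 1)

/-- The argument sequence `v, w, 0, 0, …` (for applying binary operations). -/
def duo {V : Type*} [Zero V] (v w : V) : ℕ → V := fun n =>
  if n = 0 then v else if n = 1 then w else 0

/-- Membership in `ADer^a(V)`: an alternating `(a+1)`-linear map which (for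
`a ≥ 0`) is a derivation in its first (hence, by skew-symmetry, in each)
argument; `ADer^{-1}(V) = V`. -/
def MemADer (k : Type*) {V : Type*} [CommRing k] [CommRing V] [Algebra k V]
    (a : ℤ) (A : Op V) : Prop :=
  IsMultilinearOn k (ar a) A ∧ IsAlternatingOn (ar a) A ∧
    (0 ≤ a → ∀ (f g : V) (x : ℕ → V),
      A (consV (f * g) x) = f * A (consV g x) + g * A (consV f x))

/-- Membership in `ADiff_1^a(V)`: an alternating `(a+1)`-linear map which (for
`a ≥ 0`) is a first-order differential operator in its first (hence in each)
argument; `ADiff_1^{-1}(V) = V`. -/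
def MemADiff1 (k : Type*) {V : Type*} [CommRing k] [CommRing V] [Algebra k V]
    (a : ℤ) (A : Op V) : Prop :=
  IsMultilinearOn k (ar a) A ∧ IsAlternatingOn (ar a) A ∧
    (0 ≤ a → ∀ (f g : V) (x : ℕ → V),
      A (consV (f * g) x) =
        f * A (consV g x) + g * A (consV f x) - f * g * A (consV 1 x))

/-- `D : V → V` is a differential operator of order `≤ n` on the commutative
algebra `V`. -/
def DiffOrderLe {V : Type*} [CommRing V] : ℕ → (V → V) → Prop
  | 0 => fun D => ∀ f x, D (f * x) = f * D x
  | n + 1 => fun D => ∀ f : V, DiffOrderLe n fun x => D (f * x) - f * D x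

/-- Membership in `ADiff^a(V)`: an alternating `(a+1)`-linear map which is a
differential operator of some finite order in each argument separately
(the other arguments being fixed); `ADiff^{-1}(V) = V`. -/
def MemADiff (k : Type*) {V : Type*} [CommRing k] [CommRing V] [Algebra k V]
    (a : ℤ) (A : Op V) : Prop :=
  IsMultilinearOn k (ar a) A ∧ IsAlternatingOn (ar a) A ∧
    ∀ i, i < ar a → ∃ n, ∀ x : ℕ → V,
      DiffOrderLe n fun v => A (Function.update x i v)

/-- The identity map `I ∈ A^0(V)`. -/
def Iop {V : Type*} : Op V := fun x => x 0

/-- The insertion `i_1 A` of the unit `1 ∈ V = A^{-1}(V)` into `A ∈ A^a(V)`;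
for `a ≥ 0` this is `A(1,·,…,·)`. -/
def iUnit {V : Type*} [CommRing V] (a : ℤ) (A : Op V) : Op V :=
  nrIns (ar a) 0 A fun _ => 1

/-- Application of a degree-0 (i.e. unary) operation to an element of `V`. -/
def app1 {V : Type*} (X : Op V) (v : V) : V := X fun _ => v

/-- The commutator `X∘Y − Y∘X` of two degree-0 operations. -/
def commOp {V : Type*} [AddCommGroup V] (X Y : Op V) : Op V := fun x =>
  app1 X (app1 Y (x 0)) - app1 Y (app1 X (x 0))

/-- The iterated wedge product `X_1 ∧ … ∧ X_m` of a list of degree-0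
operations (with the empty product being the unit `1 ∈ V = A^{-1}(V)`). -/
def wedgeList {V : Type*} [CommRing V] : List (Op V) → Op V
  | [] => fun _ => 1
  | X :: l => wedge 1 l.length X (wedgeList l)


/-- Permutations of `Fin (n + 1)` obtained by letting `τ` act on the nonzero elements. -/
def extendPerm {n : ℕ} (τ : Equiv.Perm (Fin n)) : Equiv.Perm (Fin (n + 1)) :=
  Equiv.Perm.decomposeFin.symm (0, τ)

@[simp] lemma extendPerm_zero {n : ℕ} (τ : Equiv.Perm (Fin n)) : extendPerm τ 0 = 0 := by
  simp [extendPerm]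

@[simp] lemma extendPerm_succ {n : ℕ} (τ : Equiv.Perm (Fin n)) (i : Fin n) :
    extendPerm τ i.succ = (τ i).succ := by
  simp [extendPerm]

@[simp] lemma sign_extendPerm {n : ℕ} (τ : Equiv.Perm (Fin n)) :
    Equiv.Perm.sign (extendPerm τ) = Equiv.Perm.sign τ := by
  simp [extendPerm]

lemma extendPerm_injective {n : ℕ} :
    Function.Injective (extendPerm : Equiv.Perm (Fin n) → Equiv.Perm (Fin (n + 1))) := by
  intro σ τ h
  simpa [extendPerm] using h

lemma exists_extendPerm_eq {n : ℕ} (σ : Equiv.Perm (Fin (n + 1))) (h : σ 0 = 0) :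
    ∃ τ, extendPerm τ = σ := by
  obtain ⟨⟨p, τ⟩, rfl⟩ := Equiv.Perm.decomposeFin.symm.surjective σ
  have hp : p = 0 := by simpa using h
  exact ⟨τ, by rw [hp, extendPerm]⟩

lemma extendPerm_mem_unshuffles {n p : ℕ} (τ : Equiv.Perm (Fin n)) :
    extendPerm τ ∈ Unshuffles (n + 1) (p + 1) ↔ τ ∈ Unshuffles n p := by
  simp only [Unshuffles, Finset.mem_filter, Finset.mem_univ, true_and]
  constructor
  · rintro ⟨h1, h2⟩
    refine ⟨fun i j hij hj => ?_, fun i j hij hj => ?_⟩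
    · simpa using h1 i.succ j.succ (by simpa using hij) (by simpa using hj)
    · simpa using h2 i.succ j.succ (by simpa using hij) (by simpa using hj)
  · rintro ⟨h1, h2⟩
    refine ⟨fun i j hij hj => ?_, fun i j hij hj => ?_⟩
    · induction j using Fin.cases with
      | zero => simp at hij
      | succ j =>
        induction i using Fin.cases with
        | zero => simp
        | succ i => simpa using h1 i j (by simpa using hij) (by simpa using hj)
    · induction j using Fin.cases with
      | zero => simp at hij
      | succ j =>
        induction i using Fin.cases with
        | zero => simp
        | succ i => simpa using h2 i j (by simpa using hij) (by simpa using hj)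

/-- The permutation sending `p` to `0` and acting by `τ` on the remaining elements. -/
def insertPerm {n : ℕ} (p : Fin (n + 1)) (τ : Equiv.Perm (Fin n)) :
    Equiv.Perm (Fin (n + 1)) :=
  extendPerm τ * p.cycleRange

@[simp] lemma insertPerm_self {n : ℕ} (p : Fin (n + 1)) (τ : Equiv.Perm (Fin n)) :
    insertPerm p τ p = 0 := by
  simp [insertPerm]

@[simp] lemma insertPerm_succAbove {n : ℕ} (p : Fin (n + 1)) (τ : Equiv.Perm (Fin n))
    (i : Fin n) : insertPerm p τ (p.succAbove i) = (τ i).succ := by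
  simp [insertPerm]

lemma sign_insertPerm {n : ℕ} (p : Fin (n + 1)) (τ : Equiv.Perm (Fin n)) :
    Equiv.Perm.sign (insertPerm p τ) = (-1) ^ (p : ℕ) * Equiv.Perm.sign τ := by
  simp [insertPerm, mul_comm]

lemma insertPerm_injective {n : ℕ} (p : Fin (n + 1)) :
    Function.Injective (insertPerm p : Equiv.Perm (Fin n) → _) := fun _ _ h =>
  extendPerm_injective (mul_right_cancel h)

lemma exists_insertPerm_eq {n : ℕ} (p : Fin (n + 1)) (σ : Equiv.Perm (Fin (n + 1)))
    (h : σ p = 0) : ∃ τ, insertPerm p τ = σ := by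
  obtain ⟨τ, hτ⟩ := exists_extendPerm_eq (σ * p.cycleRange⁻¹) (by simp [h])
  exact ⟨τ, by simp [insertPerm, hτ]⟩

lemma insertPerm_mem_unshuffles {n : ℕ} (p : Fin (n + 1)) (τ : Equiv.Perm (Fin n)) :
    insertPerm p τ ∈ Unshuffles (n + 1) p ↔ τ ∈ Unshuffles n p := by
  have key : ∀ i : Fin n, ((p.succAbove i : Fin (n + 1)) : ℕ) =
      if (i : ℕ) < p then (i : ℕ) else i + 1 := by
    intro i
    simp only [Fin.succAbove, Fin.lt_def, Fin.val_castSucc]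
    split_ifs <;> simp
  simp only [Unshuffles, Finset.mem_filter, Finset.mem_univ, true_and]
  constructor
  · rintro ⟨h1, h2⟩
    refine ⟨fun i j hij hj => ?_, fun i j hij hj => ?_⟩
    · simpa using h1 (p.succAbove i) (p.succAbove j)
        (by rw [key, key]; split_ifs <;> omega) (by rw [key]; split_ifs; omega)
    · simpa using h2 (p.succAbove i) (p.succAbove j)
        (by rw [key, key]; split_ifs <;> omega) (by rw [key]; split_ifs <;> omega)
  · rintro ⟨h1, h2⟩
    refine ⟨fun i j hij hj => ?_, fun i j hij hj => ?_⟩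
    · induction i using Fin.succAboveCases p with
      | x => omega
      | p i =>
        induction j using Fin.succAboveCases p with
        | x => omega
        | p j =>
          simp only [key] at hij hj
          have := h1 i j (by split_ifs at hij hj <;> omega) (by split_ifs at hj <;> omega)
          simpa using this
    · induction j using Fin.succAboveCases p with
      | x => omega
      | p j =>
        induction i using Fin.succAboveCases p with
        | x => simp
        | p i =>
          simp only [key] at hij hj
          have := h2 i j (by split_ifs at hij hj <;> omega) (by split_ifs at hj <;> omega)
          simpa using this

lemma filter_unshuffles_zero (n p : ℕ) :
    (Unshuffles (n + 1) (p + 1)).filter (fun σ => σ 0 = 0) =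
      (Unshuffles n p).image extendPerm := by
  ext σ
  simp only [Finset.mem_filter, Finset.mem_image]
  constructor
  · rintro ⟨h, h0⟩
    obtain ⟨τ, rfl⟩ := exists_extendPerm_eq σ h0
    exact ⟨τ, (extendPerm_mem_unshuffles τ).1 h, rfl⟩
  · rintro ⟨τ, h, rfl⟩
    exact ⟨(extendPerm_mem_unshuffles τ).2 h, by simp⟩

lemma filter_unshuffles_self {n : ℕ} (p : Fin (n + 1)) :
    (Unshuffles (n + 1) p).filter (fun σ => σ p = 0) =
      (Unshuffles n p).image (insertPerm p) := by
  ext σ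
  simp only [Finset.mem_filter, Finset.mem_image]
  constructor
  · rintro ⟨h, h0⟩
    obtain ⟨τ, rfl⟩ := exists_insertPerm_eq p σ h0
    exact ⟨τ, (insertPerm_mem_unshuffles p τ).1 h, rfl⟩
  · rintro ⟨τ, h, rfl⟩
    exact ⟨(insertPerm_mem_unshuffles p τ).2 h, by simp⟩

/-- An unshuffle attains its least value at the start of one of the two blocks. -/
lemma unshuffle_eq_zero {n p : ℕ} {σ : Equiv.Perm (Fin (n + 1))}
    (hσ : σ ∈ Unshuffles (n + 1) p) (i : Fin (n + 1)) (hi : σ i = 0) :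
    (i : ℕ) = 0 ∨ (i : ℕ) = p := by
  simp only [Unshuffles, Finset.mem_filter, Finset.mem_univ, true_and] at hσ
  by_contra! h
  rcases lt_or_ge (i : ℕ) p with hp | hp
  · have := hσ.1 0 i (by rw [Fin.val_zero]; omega) hp
    simp [hi] at this
  · have := hσ.2 ⟨p, by omega⟩ i (by simp; omega) le_rfl
    simp [hi] at this

/-- The argument sequence `x ∘ σ`, padded by zeros. -/
def permArg {V : Type*} [Zero V] {n : ℕ} (σ : Equiv.Perm (Fin n)) (x : ℕ → V) : ℕ → V :=
  fun i => if h : i < n then x (σ ⟨i, h⟩) else 0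

/-- Insertion of `v` at position `p` of a sequence. -/
def insertAt {V : Type*} (p : ℕ) (v : V) (x : ℕ → V) : ℕ → V := fun i =>
  if i < p then x i else if i = p then v else x (i - 1)

lemma permArg_extendPerm {V : Type*} [Zero V] {n : ℕ} (τ : Equiv.Perm (Fin n)) (v : V)
    (x : ℕ → V) : permArg (extendPerm τ) (consV v x) = consV v (permArg τ x) := by
  funext i
  rcases i with _ | i
  · simp [permArg, consV]
  · by_cases h : i < n
    · have : extendPerm τ ⟨i + 1, by omega⟩ = (τ ⟨i, h⟩).succ := extendPerm_succ τ ⟨i, h⟩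
      rw [permArg, dif_pos (by omega), this]
      simp [permArg, consV, h]
    · simp [permArg, consV, h]

lemma permArg_insertPerm {V : Type*} [Zero V] {n : ℕ} (p : Fin (n + 1))
    (τ : Equiv.Perm (Fin n)) (v : V) (x : ℕ → V) :
    permArg (insertPerm p τ) (consV v x) = insertAt p v (permArg τ x) := by
  funext i
  by_cases h : i < n + 1
  · obtain ⟨i, rfl⟩ : ∃ j : Fin (n + 1), (j : ℕ) = i := ⟨⟨i, h⟩, rfl⟩
    induction i using Fin.succAboveCases p with
    | x => simp [permArg, insertAt, consV, Fin.is_le]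
    | p i =>
      have hp := Fin.succAbove_ne p i
      simp only [permArg, Fin.is_lt, dite_true, Fin.eta, insertPerm_succAbove, consV,
        insertAt]
      rw [Fin.succAbove] at hp ⊢
      simp only [Fin.lt_def, Fin.val_castSucc] at hp ⊢
      split_ifs at hp ⊢ <;> simp_all <;> omega
  · have h1 : ¬ i < p := by omega
    have h2 : i ≠ p := by omega
    have h3 : ¬ i - 1 < n := by omega
    simp [permArg, insertAt, h, h1, h2, h3]

/-- The signed sum of `F (x ∘ σ)` over unshuffles `σ`. -/
def unshuffleSum {V : Type*} [AddCommGroup V] (n p : ℕ) (F : Op V) : Op V := fun x =>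
  ∑ σ ∈ Unshuffles n p, ((Equiv.Perm.sign σ : ℤˣ) : ℤ) • F (permArg σ x)

lemma unshuffleSum_self {V : Type*} [AddCommGroup V] {n : ℕ} (p : Fin (n + 1)) (F : Op V)
    (v : V) (x : ℕ → V) :
    ∑ σ ∈ (Unshuffles (n + 1) p).filter (fun σ => σ p = 0),
      ((Equiv.Perm.sign σ : ℤˣ) : ℤ) • F (permArg σ (consV v x)) =
    ((-1 : ℤ) ^ (p : ℕ)) • unshuffleSum n p (fun y => F (insertAt p v y)) x := by
  rw [filter_unshuffles_self, Finset.sum_image (fun _ _ _ _ h => insertPerm_injective p h),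
    unshuffleSum, Finset.smul_sum]
  refine Finset.sum_congr rfl fun τ _ => ?_
  rw [permArg_insertPerm, sign_insertPerm, smul_smul]
  simp

lemma unshuffleSum_head {V : Type*} [AddCommGroup V] (n p : ℕ) (F : Op V)
    (v : V) (x : ℕ → V) :
    ∑ σ ∈ (Unshuffles (n + 1) (p + 1)).filter (fun σ => σ 0 = 0),
      ((Equiv.Perm.sign σ : ℤˣ) : ℤ) • F (permArg σ (consV v x)) =
    unshuffleSum n p (fun y => F (consV v y)) x := by
  rw [filter_unshuffles_zero, Finset.sum_image (fun _ _ _ _ h => extendPerm_injective h),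
    unshuffleSum]
  refine Finset.sum_congr rfl fun τ _ => ?_
  rw [permArg_extendPerm, sign_extendPerm]

lemma unshuffleSum_zero_cons {V : Type*} [AddCommGroup V] (n : ℕ) (F : Op V)
    (v : V) (x : ℕ → V) :
    unshuffleSum (n + 1) 0 F (consV v x) = unshuffleSum n 0 (fun y => F (insertAt 0 v y)) x := by
  have h := unshuffleSum_self (0 : Fin (n + 1)) F v x
  rw [Finset.filter_true_of_mem] at h
  · simpa [unshuffleSum] using h
  · intro σ hσ
    have := unshuffle_eq_zero hσ (σ.symm 0) (by simp)
    have h0 : σ.symm 0 = 0 := by ext; simpa using this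
    rw [Equiv.symm_apply_eq] at h0
    exact h0.symm

lemma unshuffleSum_last_cons {V : Type*} [AddCommGroup V] (n : ℕ) (F : Op V)
    (v : V) (x : ℕ → V) :
    unshuffleSum (n + 1) (n + 1) F (consV v x) =
      unshuffleSum n n (fun y => F (consV v y)) x := by
  have h := unshuffleSum_head n n F v x
  rwa [Finset.filter_true_of_mem] at h
  intro σ hσ
  have := unshuffle_eq_zero hσ (σ.symm 0) (by simp)
  have h0 : σ.symm 0 = 0 := by ext; rw [Fin.val_zero]; omega
  rw [Equiv.symm_apply_eq] at h0
  exact h0.symm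

lemma unshuffleSum_succ_cons {V : Type*} [AddCommGroup V] (n p : ℕ) (hp : p + 1 ≤ n)
    (F : Op V) (v : V) (x : ℕ → V) :
    unshuffleSum (n + 1) (p + 1) F (consV v x) =
      unshuffleSum n p (fun y => F (consV v y)) x +
      ((-1 : ℤ) ^ (p + 1)) • unshuffleSum n (p + 1) (fun y => F (insertAt (p + 1) v y)) x := by
  rw [← unshuffleSum_head, ← unshuffleSum_self (⟨p + 1, by omega⟩ : Fin (n + 1)),
    unshuffleSum, ← Finset.sum_filter_add_sum_filter_not _ (fun σ => σ 0 = 0)]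
  congr 2
  refine Finset.filter_congr fun σ hσ => ?_
  constructor
  · intro h
    have h1 := unshuffle_eq_zero hσ (σ.symm 0) (by simp)
    have h2 : σ.symm 0 ≠ 0 := by
      rw [Ne, Equiv.symm_apply_eq]; exact fun h' => h h'.symm
    have h3 : σ.symm 0 = ⟨p + 1, by omega⟩ := by
      ext
      rcases h1 with h1 | h1
      · exact absurd (Fin.ext h1) h2
      · exact h1
    rw [Equiv.symm_apply_eq] at h3
    exact h3.symm
  · intro h h'
    have := σ.injective (h.trans h'.symm)
    simp [Fin.ext_iff] at this

lemma consV_head_tail {V : Type*} (x : ℕ → V) : consV (x 0) (fun j => x (j + 1)) = x := by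
  funext j
  rcases j with _ | j <;> simp [consV]

lemma update_consV_zero {V : Type*} (x : ℕ → V) (v w : V) :
    Function.update (consV v x) 0 w = consV w x := by
  funext j
  rcases j with _ | j <;> simp [consV]

lemma update_consV_succ {V : Type*} (x : ℕ → V) (v w : V) (i : ℕ) :
    Function.update (consV v x) (i + 1) w = consV v (Function.update x i w) := by
  funext j
  rcases j with _ | j <;> simp [consV, Function.update_apply]

lemma unshuffleSum_zero_eq {V : Type*} [AddCommGroup V] (n : ℕ) (F : Op V) (x : ℕ → V) :
    unshuffleSum n 0 F x = F (fun i => if i < n then x i else 0) := by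
  induction n generalizing F x with
  | zero =>
    have h : ∀ σ : Equiv.Perm (Fin 0), permArg σ x = fun _ => 0 := fun σ => by
      funext i; simp [permArg]
    simp [unshuffleSum, Unshuffles, h]
  | succ n ih =>
    rw [← consV_head_tail x, unshuffleSum_zero_cons, ih]
    congr 1
    funext j
    rcases j with _ | j <;> simp [consV, insertAt]

lemma unshuffleSum_neg {V : Type*} [AddCommGroup V] (n p : ℕ) (F : Op V) (x : ℕ → V) :
    unshuffleSum n p (fun y => -F y) x = -unshuffleSum n p F x := by
  simp [unshuffleSum]

section AlternatingOperations

variable {V : Type*} [AddCommGroup V]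

/-- `A` is an alternating multiadditive operation of degree `a`; it vanishes if `a < -1`. -/
structure IsAltOp (a : ℤ) (A : Op V) : Prop where
  dependsOn : DependsOn (ar a) A
  map_update_add : ∀ i, i < ar a → ∀ (x : ℕ → V) (v w : V),
    A (Function.update x i (v + w)) = A (Function.update x i v) + A (Function.update x i w)
  alternating : IsAlternatingOn (ar a) A
  eq_zero : a < -1 → A = 0

lemma MemA.isAltOp {k : Type*} [Semiring k] [Module k V] {a : ℤ} {A : Op V}
    (h : MemA k a A) (ha : -1 ≤ a) : IsAltOp a A :=
  ⟨h.1.1, fun i hi => (h.1.2 i hi).2, h.2, fun h => by omega⟩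

/-- The contraction `A(v, ·, …, ·)` of an operation of degree `a`. -/
def contract (a : ℤ) (v : V) (A : Op V) : Op V :=
  if a < 0 then 0 else fun x => A (consV v x)

lemma contract_of_neg {a : ℤ} (ha : a < 0) (v : V) (A : Op V) : contract a v A = 0 :=
  if_pos ha

lemma contract_apply {a : ℤ} (ha : 0 ≤ a) (v : V) (A : Op V) (x : ℕ → V) :
    contract a v A x = A (consV v x) := by
  simp [contract, not_lt.2 ha]

lemma contract_zero (a : ℤ) (v : V) : contract a v (0 : Op V) = 0 := by
  unfold contract; split_ifs <;> rfl

lemma contract_add (a : ℤ) (v : V) (A B : Op V) :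
    contract a v (A + B) = contract a v A + contract a v B := by
  unfold contract; split_ifs
  · simp
  · rfl

lemma contract_sub (a : ℤ) (v : V) (A B : Op V) :
    contract a v (A - B) = contract a v A - contract a v B := by
  unfold contract; split_ifs
  · simp
  · rfl

lemma contract_zsmul (a n : ℤ) (v : V) (A : Op V) :
    contract a v (n • A) = n • contract a v A := by
  unfold contract; split_ifs
  · simp
  · rfl

namespace IsAltOp

variable {a b c : ℤ} {A B C : Op V}

lemma zero (a : ℤ) : IsAltOp a (0 : Op V) :=
  ⟨fun _ _ _ => rfl, by simp, fun _ _ _ _ _ _ _ => rfl, fun _ => rfl⟩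

lemma add (hA : IsAltOp a A) (hB : IsAltOp a B) : IsAltOp a (A + B) where
  dependsOn x y h := by simp [hA.dependsOn x y h, hB.dependsOn x y h]
  map_update_add i hi x v w := by
    simp only [Pi.add_apply, hA.map_update_add i hi, hB.map_update_add i hi]; abel
  alternating x i j hi hj hij h := by
    simp [hA.alternating x i j hi hj hij h, hB.alternating x i j hi hj hij h]
  eq_zero h := by simp [hA.eq_zero h, hB.eq_zero h]

lemma zsmul (hA : IsAltOp a A) (n : ℤ) : IsAltOp a (n • A) where
  dependsOn x y h := by simp [hA.dependsOn x y h]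
  map_update_add i hi x v w := by simp [hA.map_update_add i hi]
  alternating x i j hi hj hij h := by simp [hA.alternating x i j hi hj hij h]
  eq_zero h := by simp [hA.eq_zero h]

lemma map_cons_add (hA : IsAltOp a A) (ha : 0 ≤ a) (v w : V) (x : ℕ → V) :
    A (consV (v + w) x) = A (consV v x) + A (consV w x) := by
  simpa only [update_consV_zero] using
    hA.map_update_add 0 (by unfold ar; omega) (consV 0 x) v w

lemma map_update_swap (hA : IsAltOp a A) {i j : ℕ} (hi : i < ar a) (hj : j < ar a)
    (hij : i ≠ j) (x : ℕ → V) (v w : V) :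
    A (Function.update (Function.update x i v) j w) =
      -A (Function.update (Function.update x i w) j v) := by
  have hadd : ∀ u u' t, A (Function.update (Function.update x i (u + u')) j t) =
      A (Function.update (Function.update x i u) j t) +
        A (Function.update (Function.update x i u') j t) := by
    intro u u' t
    simp only [Function.update_comm hij]
    exact hA.map_update_add i hi _ _ _
  have hself : ∀ u, A (Function.update (Function.update x i u) j u) = 0 := fun u =>
    hA.alternating _ i j hi hj hij (by simp [hij])
  have h := hself (v + w)
  rw [hadd, hA.map_update_add j hj, hA.map_update_add j hj, hself, hself, zero_add,
    add_zero] at h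
  exact eq_neg_of_add_eq_zero_left h

lemma map_cons_swap (hA : IsAltOp a A) (ha : 1 ≤ a) (v w : V) (x : ℕ → V) :
    A (consV v (consV w x)) = -A (consV w (consV v x)) := by
  have := hA.map_update_swap (i := 0) (j := 1) (by unfold ar; omega) (by unfold ar; omega)
    (by simp) (consV 0 (consV 0 x)) v w
  simpa only [update_consV_zero, update_consV_succ _ _ _ 0] using this

lemma contract (hA : IsAltOp a A) (v : V) : IsAltOp (a - 1) (contract a v A) := by
  rcases lt_or_ge a 0 with ha | ha
  · rw [contract_of_neg ha]
    exact zero _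
  have har : ar a = ar (a - 1) + 1 := by unfold ar; omega
  refine ⟨fun x y h => ?_, fun i hi x u w => ?_, fun x i j hi hj hij h => ?_,
    fun h => by omega⟩
  · simp only [contract_apply ha]
    refine hA.dependsOn _ _ fun i hi => ?_
    rcases i with _ | i
    · simp [consV]
    · simpa [consV] using h i (by omega)
  · simp only [contract_apply ha, ← update_consV_succ]
    exact hA.map_update_add (i + 1) (by omega) _ _ _
  · rw [contract_apply ha]
    exact hA.alternating _ (i + 1) (j + 1) (by omega) (by omega) (by omega)
      (by simpa [consV] using h)

lemma contract_add_left (hA : IsAltOp a A) (v w : V) :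
    JacobiRevisited.contract a (v + w) A =
      JacobiRevisited.contract a v A + JacobiRevisited.contract a w A := by
  rcases lt_or_ge a 0 with ha | ha
  · simp [contract_of_neg ha]
  · funext x
    simp [contract_apply ha, hA.map_cons_add ha]

lemma contract_contract_self (hA : IsAltOp a A) (v : V) :
    JacobiRevisited.contract (a - 1) v (JacobiRevisited.contract a v A) = 0 := by
  rcases lt_or_ge (a - 1) 0 with ha | ha
  · exact contract_of_neg ha _ _
  · funext x
    rw [contract_apply ha, contract_apply (by omega)]
    exact hA.alternating _ 0 1 (by unfold ar; omega) (by unfold ar; omega) (by simp)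
      (by simp [consV])

lemma of_contract (ha : 0 ≤ a)
    (h : ∀ v, IsAltOp (a - 1) (JacobiRevisited.contract a v A))
    (hadd : ∀ v w, JacobiRevisited.contract a (v + w) A =
      JacobiRevisited.contract a v A + JacobiRevisited.contract a w A)
    (hself : ∀ v, JacobiRevisited.contract (a - 1) v (JacobiRevisited.contract a v A) = 0) :
    IsAltOp a A := by
  have har : ar a = ar (a - 1) + 1 := by unfold ar; omega
  have hA : ∀ x, A x = JacobiRevisited.contract a (x 0) A (fun j => x (j + 1)) := fun x => by
    rw [contract_apply ha, consV_head_tail]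
  have halt : ∀ x : ℕ → V, ∀ j, j + 1 < ar a → x 0 = x (j + 1) → A x = 0 := by
    intro x j hj hx
    have h1 : 0 ≤ a - 1 := by unfold ar at hj; omega
    have hz : ∀ y, JacobiRevisited.contract a (x 0) A (consV (x 0) y) = 0 := fun y => by
      have := congrFun (hself (x 0)) y
      rwa [contract_apply h1] at this
    rw [hA]
    rcases j with _ | j
    · rw [← consV_head_tail (fun j => x (j + 1))]
      simpa only [zero_add, ← hx] using hz _
    · have hs := (h (x 0)).map_update_swap (i := 0) (j := j + 1) (by omega) (by omega)
        (by simp) (fun j => x (j + 1)) (x 1) (x 0)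
      have e1 : Function.update (Function.update (fun j => x (j + 1)) 0 (x 1)) (j + 1) (x 0) =
          fun j => x (j + 1) := by
        rw [hx]; simp
      have e2 : ∀ w, Function.update (Function.update (fun j => x (j + 1)) 0 (x 0)) (j + 1) w =
          consV (x 0) (Function.update (fun j => x (j + 2)) j w) := by
        intro w
        rw [← update_consV_succ, ← consV_head_tail (fun j => x (j + 1)), update_consV_zero]
      rw [e1, e2, hz, neg_zero] at hs
      exact hs
  refine ⟨fun x y hxy => ?_, fun i hi x v w => ?_, fun x i j hi hj hij hx => ?_,
    fun h => by omega⟩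
  · rw [hA x, hA y, hxy 0 (by omega)]
    exact (h _).dependsOn _ _ fun i hi => hxy (i + 1) (by omega)
  · rw [← consV_head_tail x]
    rcases i with _ | i
    · simp only [update_consV_zero, ← contract_apply ha, hadd, Pi.add_apply]
    · simp only [update_consV_succ, ← contract_apply ha]
      exact (h _).map_update_add i (by omega) _ _ _
  · rcases i with _ | i
    · obtain ⟨j, rfl⟩ := Nat.exists_eq_succ_of_ne_zero hij.symm
      exact halt x j hj hx
    · rcases j with _ | j
      · exact halt x i hi hx.symm
      · rw [hA]
        exact (h _).alternating _ i j (by omega) (by omega) (by omega) hx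

lemma ext_contract (hA : IsAltOp a A) (hB : IsAltOp a B) (ha : a ≠ -1)
    (h : ∀ v, JacobiRevisited.contract a v A = JacobiRevisited.contract a v B) : A = B := by
  rcases lt_or_ge a 0 with ha' | ha'
  · rw [hA.eq_zero (by omega), hB.eq_zero (by omega)]
  · funext x
    have := congrFun (h (x 0)) (fun j => x (j + 1))
    rwa [contract_apply ha', contract_apply ha', consV_head_tail] at this

end IsAltOp

lemma nrIns_zero_arity (q : ℕ) (A B : Op V) : nrIns 0 q A B = 0 := by
  funext x
  simp [nrIns]

lemma nrIns_succ_apply (m q : ℕ) (A B : Op V) (x : ℕ → V) :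
    nrIns (m + 1) q A B x = ∑ σ ∈ Unshuffles (m + 1 + q - 1) q,
      ((Equiv.Perm.sign σ : ℤˣ) : ℤ) •
        A (consV (B fun i => if hi : i < q then x (σ ⟨i, by omega⟩) else 0)
          (fun j => permArg σ x (q + j))) := by
  rw [nrIns, dif_neg (Nat.succ_ne_zero m)]
  refine Finset.sum_congr rfl fun σ _ => ?_
  congr 2
  funext j
  rcases j with _ | j
  · simp [consV]
  · simp only [consV, permArg]
    by_cases h : j + 1 < m + 1
    · have h' : q + j < m + 1 + q - 1 := by omega
      simp only [Nat.add_one_ne_zero, dite_false, if_false, h, dite_true,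
        Nat.add_sub_cancel, h']
      rfl
    · have h' : ¬ q + j < m + 1 + q - 1 := by omega
      rw [dif_neg (Nat.succ_ne_zero j), dif_neg h, if_neg (Nat.succ_ne_zero j),
        Nat.add_sub_cancel, dif_neg h']

/-- The summand of the insertion attached to the identity permutation. -/
def insertHead (q : ℕ) (A B : Op V) : Op V := fun y => A (consV (B y) (fun j => y (q + j)))

lemma nrIns_eq_unshuffleSum {m q n : ℕ} (hn : n = m + q) (A : Op V) {B : Op V}
    (hB : DependsOn q B) : nrIns (m + 1) q A B = unshuffleSum n q (insertHead q A B) := by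
  obtain rfl : n = m + 1 + q - 1 := by omega
  funext x
  rw [nrIns_succ_apply, unshuffleSum]
  refine Finset.sum_congr rfl fun σ _ => ?_
  rw [insertHead, hB _ (permArg σ x)]
  intro i hi
  rw [permArg, dif_pos hi, dif_pos (by omega)]

lemma nrIns_zero_left (p q : ℕ) (B : Op V) : nrIns p q 0 B = 0 := by
  funext x
  simp [nrIns]

lemma nrIns_add_left (p q : ℕ) (A A' B : Op V) :
    nrIns p q (A + A') B = nrIns p q A B + nrIns p q A' B := by
  funext x
  rcases p with _ | p
  · simp [nrIns]
  · simp [nrIns_succ_apply, Finset.sum_add_distrib]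

lemma nrIns_zsmul_left (p q : ℕ) (n : ℤ) (A B : Op V) :
    nrIns p q (n • A) B = n • nrIns p q A B := by
  funext x
  rcases p with _ | p
  · simp [nrIns]
  · simp only [nrIns_succ_apply, Pi.smul_apply, Finset.smul_sum]
    exact Finset.sum_congr rfl fun σ _ => smul_comm _ _ _

lemma nrIns_add_right {a : ℤ} {A : Op V} (hA : IsAltOp a A) (q : ℕ) (B B' : Op V) :
    nrIns (ar a) q A (B + B') = nrIns (ar a) q A B + nrIns (ar a) q A B' := by
  rcases lt_or_ge a 0 with ha | ha
  · have : ar a = 0 := by unfold ar; omega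
    simp [this, nrIns_zero_arity]
  · obtain ⟨m, hm⟩ : ∃ m, ar a = m + 1 := ⟨a.toNat, by unfold ar; omega⟩
    funext x
    simp [hm, nrIns_succ_apply, hA.map_cons_add ha, Finset.sum_add_distrib]

lemma nrIns_zsmul_right {a : ℤ} {A : Op V} (hA : IsAltOp a A) (q : ℕ) (n : ℤ) (B : Op V) :
    nrIns (ar a) q A (n • B) = n • nrIns (ar a) q A B :=
  map_zsmul (AddMonoidHom.mk' (nrIns (ar a) q A) (nrIns_add_right hA q)) n B

lemma nrIns_zero_right {a : ℤ} {A : Op V} (hA : IsAltOp a A) (q : ℕ) :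
    nrIns (ar a) q A 0 = 0 :=
  map_zero (AddMonoidHom.mk' (nrIns (ar a) q A) (nrIns_add_right hA q))

/-- Inserting a constant is contraction with its value. -/
lemma nrIns_neg_one_right {a : ℤ} {A B : Op V} (hA : IsAltOp a A) (hB : IsAltOp (-1) B) :
    nrIns (ar a) (ar (-1)) A B = contract a (B 0) A := by
  rcases lt_or_ge a 0 with ha | ha
  · have : ar a = 0 := by unfold ar; omega
    rw [this, nrIns_zero_arity, contract_of_neg ha]
  · obtain ⟨m, hm⟩ : ∃ m, ar a = m + 1 := ⟨a.toNat, by unfold ar; omega⟩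
    have h0 : ar (-1) = 0 := rfl
    have hB' := hB.dependsOn
    rw [h0] at hB' ⊢
    rw [hm, nrIns_eq_unshuffleSum rfl A hB']
    funext x
    rw [unshuffleSum_zero_eq, contract_apply ha, insertHead, hB' _ 0 (by simp)]
    refine hA.dependsOn _ _ fun i hi => ?_
    rcases i with _ | i
    · simp [consV]
    · simp [consV, show i < m by omega]

lemma insertHead_insertAt {a : ℤ} {A B : Op V} (hA : IsAltOp a A) (ha : 1 ≤ a) {q : ℕ}
    (hB : DependsOn q B) (v : V) :
    (fun y => insertHead q A B (insertAt q v y)) =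
      fun y => -insertHead q (contract a v A) B y := by
  funext y
  have e : (fun j => insertAt q v y (q + j)) = consV v (fun j => y (q + j)) := by
    funext j
    rcases j with _ | j
    · simp [insertAt, consV]
    · have h1 : ¬ q + (j + 1) < q := by omega
      have h2 : q + (j + 1) ≠ q := by omega
      simp only [insertAt, consV, if_neg h1, if_neg h2]
      simp [← add_assoc]
  rw [insertHead, insertHead, contract_apply (by omega), e, hA.map_cons_swap ha,
    hB _ y fun i hi => by simp [insertAt, hi]]

lemma insertHead_consV {b : ℤ} (A B : Op V) (hb : 0 ≤ b) (q : ℕ) (v : V) :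
    (fun y => insertHead (q + 1) A B (consV v y)) = insertHead q A (contract b v B) := by
  funext y
  have : ∀ j, q + 1 + j = q + j + 1 := fun j => by omega
  simp [insertHead, contract_apply hb, consV, this]

/-- Contraction is a graded derivation of the insertion product. -/
lemma contract_nrIns {a b : ℤ} {A B : Op V} (hA : IsAltOp a A) (hB : IsAltOp b B) (v : V) :
    contract (a + b) v (nrIns (ar a) (ar b) A B) =
      nrIns (ar a) (ar (b - 1)) A (contract b v B) +
        ((b.negOnePow : ℤˣ) : ℤ) • nrIns (ar (a - 1)) (ar b) (contract a v A) B := by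
  rcases lt_or_ge a 0 with ha | ha
  · have h1 : ar a = 0 := by unfold ar; omega
    have h2 : ar (a - 1) = 0 := by unfold ar; omega
    simp [h1, h2, nrIns_zero_arity, contract_zero]
  rcases lt_or_ge b (-1) with hb | hb
  · simp [hB.eq_zero hb, nrIns_zero_right hA, nrIns_zero_right (hA.contract v), contract_zero]
  obtain ⟨m, rfl⟩ := Int.eq_ofNat_of_zero_le ha
  have ham : ar (m : ℤ) = m + 1 := by unfold ar; omega
  have ham' : ar ((m : ℤ) - 1) = m := by unfold ar; omega
  have hBd := hB.dependsOn
  have hsign : ((b.negOnePow : ℤˣ) : ℤ) = -(-1) ^ ar b := by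
    obtain ⟨q, hq⟩ := Int.eq_ofNat_of_zero_le (show 0 ≤ b + 1 by omega)
    have : ar b = q := by unfold ar; omega
    rw [this, show b = q - 1 by omega, Int.negOnePow_sub, Int.negOnePow_one, Int.negOnePow_def]
    simp
  rcases eq_or_lt_of_le hb with rfl | hb
  · have h0 : ar (-1) = 0 := rfl
    rw [h0] at hBd hsign
    rw [contract_of_neg (a := -1) (by omega), nrIns_zero_right hA, zero_add, hsign, h0, ham,
      ham']
    rcases m with _ | m
    · rw [contract_of_neg (by simp), nrIns_zero_arity, smul_zero]
    · funext x
      rw [contract_apply (by push_cast; omega), nrIns_eq_unshuffleSum (n := m + 1) (by omega) A hBd,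
        unshuffleSum_zero_cons, insertHead_insertAt hA (by push_cast; omega) hBd,
        unshuffleSum_neg, nrIns_eq_unshuffleSum (n := m) rfl _ hBd]
      simp
  · obtain ⟨q, rfl⟩ := Int.eq_ofNat_of_zero_le (show 0 ≤ b by omega)
    have hbq : ar (q : ℤ) = q + 1 := by unfold ar; omega
    have hbq' : ar ((q : ℤ) - 1) = q := by unfold ar; omega
    have hcd := (hB.contract v).dependsOn
    rw [hbq'] at hcd
    rw [hbq] at hBd hsign
    rw [hsign, ham, ham', hbq, hbq', nrIns_eq_unshuffleSum (n := m + q) rfl A hcd]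
    funext x
    rw [contract_apply (by omega), nrIns_eq_unshuffleSum (n := m + q + 1) (by omega) A hBd]
    rcases m with _ | m
    · simp only [zero_add, nrIns_zero_arity, smul_zero, add_zero]
      rw [unshuffleSum_last_cons, insertHead_consV (b := q) A B (by omega)]
    · rw [unshuffleSum_succ_cons _ _ (by omega), insertHead_consV (b := q) A B (by omega),
        insertHead_insertAt hA (by push_cast; omega) hBd, unshuffleSum_neg,
        nrIns_eq_unshuffleSum (n := m + 1 + q) (by omega) _ hBd]
      simp

lemma IsAltOp.nrIns {a b : ℤ} {A B : Op V} (hA : IsAltOp a A) (hB : IsAltOp b B) :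
    IsAltOp (a + b) (nrIns (ar a) (ar b) A B) := by
  obtain ⟨n, hn⟩ : ∃ n : ℕ, a + b < n := ⟨(a + b + 1).toNat, by omega⟩
  induction n generalizing a b A B with
  | zero =>
    rcases lt_or_ge a 0 with ha | ha
    · rw [show ar a = 0 by unfold ar; omega, nrIns_zero_arity]
      exact zero _
    rcases lt_or_ge b (-1) with hb | hb
    · rw [hB.eq_zero hb, nrIns_zero_right hA]
      exact zero _
    obtain rfl : b = -1 := by push_cast at hn; omega
    rw [nrIns_neg_one_right hA hB]
    exact hA.contract _
  | succ n ih =>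
    rcases lt_or_ge (a + b) n with h | h
    · exact ih hA hB h
    have hd := contract_nrIns hA hB
    refine of_contract (by omega) (fun v => ?_) (fun v w => ?_) fun v => ?_
    · have h1 := ih hA (hB.contract v) (by push_cast at hn; omega)
      have h2 := ih (hA.contract v) hB (by push_cast at hn; omega)
      rw [← add_sub_assoc] at h1
      rw [sub_add_eq_add_sub] at h2
      rw [hd]
      exact h1.add (h2.zsmul _)
    · simp only [hd, hA.contract_add_left, hB.contract_add_left, nrIns_add_left,
        nrIns_add_right hA, smul_add]
      abel
    · have h1 := contract_nrIns hA (hB.contract v) v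
      have h2 := contract_nrIns (hA.contract v) hB v
      rw [← add_sub_assoc] at h1
      rw [sub_add_eq_add_sub] at h2
      rw [hd, contract_add, contract_zsmul, h1, h2, hB.contract_contract_self,
        hA.contract_contract_self, nrIns_zero_left, nrIns_zero_right hA, Int.negOnePow_sub,
        Int.negOnePow_one]
      simp

/-- The associator of the insertion product. -/
def insAssoc (a b c : ℤ) (A B C : Op V) : Op V :=
  nrIns (ar (c + b)) (ar a) (nrIns (ar c) (ar b) C B) A -
    nrIns (ar c) (ar (b + a)) C (nrIns (ar b) (ar a) B A)

lemma IsAltOp.insAssoc {a b c : ℤ} {A B C : Op V} (hA : IsAltOp a A) (hB : IsAltOp b B)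
    (hC : IsAltOp c C) : IsAltOp (c + b + a) (insAssoc a b c A B C) := by
  have h1 := (hC.nrIns hB).nrIns hA
  have h2 := (hC.nrIns (hB.nrIns hA)).zsmul (-1)
  rw [← add_assoc] at h2
  simpa [JacobiRevisited.insAssoc, sub_eq_add_neg] using h1.add h2

lemma contract_insAssoc {a b c : ℤ} {A B C : Op V} (hA : IsAltOp a A) (hB : IsAltOp b B)
    (hC : IsAltOp c C) (v : V) :
    contract (c + b + a) v (insAssoc a b c A B C) =
      insAssoc (a - 1) b c (contract a v A) B C +
        ((a.negOnePow : ℤˣ) : ℤ) • insAssoc a (b - 1) c A (contract b v B) C +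
        ((a.negOnePow * b.negOnePow : ℤˣ) : ℤ) •
          insAssoc a b (c - 1) A B (contract c v C) := by
  have h1 := contract_nrIns (hC.nrIns hB) hA v
  have h2 := contract_nrIns hC (hB.nrIns hA) v
  rw [contract_nrIns hC hB, nrIns_add_left, nrIns_zsmul_left] at h1
  rw [contract_nrIns hB hA, nrIns_add_right hC, nrIns_zsmul_right hC, ← add_assoc,
    Int.negOnePow_add] at h2
  unfold insAssoc
  rw [contract_sub, h1, h2]
  simp only [add_sub_assoc, sub_add_eq_add_sub, Units.val_mul]
  module

lemma insAssoc_comm_neg_one {b c : ℤ} {A B C : Op V} (hA : IsAltOp (-1) A)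
    (hB : IsAltOp b B) (hC : IsAltOp c C) :
    insAssoc (-1) b c A B C = ((b.negOnePow : ℤˣ) : ℤ) • insAssoc b (-1) c B A C := by
  have h0 : ar (-1) = 0 := rfl
  unfold insAssoc
  rw [nrIns_neg_one_right (hC.nrIns hB) hA, contract_nrIns hC hB, nrIns_neg_one_right hB hA,
    nrIns_neg_one_right hC hA, h0, nrIns_zero_arity, nrIns_zero_right hC]
  simp [sub_eq_add_neg]

lemma insAssoc_zero_left {b c : ℤ} {B C : Op V} (a : ℤ) (hB : IsAltOp b B)
    (hC : IsAltOp c C) : insAssoc a b c 0 B C = 0 := by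
  rw [insAssoc, nrIns_zero_right (hC.nrIns hB), nrIns_zero_right hB, nrIns_zero_right hC,
    sub_zero]

lemma insAssoc_zero_middle {c : ℤ} {C : Op V} (a b : ℤ) (A : Op V) (hC : IsAltOp c C) :
    insAssoc a b c A 0 C = 0 := by
  rw [insAssoc, nrIns_zero_right hC, nrIns_zero_left, nrIns_zero_left, nrIns_zero_right hC,
    sub_zero]

lemma insAssoc_of_neg {c : ℤ} (hc : c < 0) (a b : ℤ) (A B C : Op V) :
    insAssoc a b c A B C = 0 := by
  rw [insAssoc, show ar c = 0 by unfold ar; omega, nrIns_zero_arity, nrIns_zero_arity,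
    nrIns_zero_left, sub_zero]

lemma negOnePow_cases (n : ℤ) :
    ((n.negOnePow : ℤˣ) : ℤ) = 1 ∨ ((n.negOnePow : ℤˣ) : ℤ) = -1 := by
  rcases Int.units_eq_one_or n.negOnePow with h | h <;> simp [h]

/-- The associator of the insertion product is graded symmetric. -/
lemma insAssoc_comm {a b c : ℤ} {A B C : Op V} (hA : IsAltOp a A)
    (hB : IsAltOp b B) (hC : IsAltOp c C) :
    insAssoc a b c A B C =
      (((a * b).negOnePow : ℤˣ) : ℤ) • insAssoc b a c B A C := by
  obtain ⟨n, hn⟩ : ∃ n : ℕ, c + b + a < n := ⟨(c + b + a + 1).toNat, by omega⟩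
  induction n generalizing a b c A B C with
  | zero | succ n ih =>
    rcases lt_or_ge c 0 with hc | hc
    · rw [insAssoc_of_neg hc, insAssoc_of_neg hc, smul_zero]
    rcases lt_trichotomy a (-1) with ha | rfl | ha
    · rw [hA.eq_zero ha, insAssoc_zero_left a hB hC, insAssoc_zero_middle b a B hC, smul_zero]
    · rw [insAssoc_comm_neg_one hA hB hC, neg_one_mul, Int.negOnePow_neg]
    rcases lt_trichotomy b (-1) with hb | rfl | hb
    · rw [hB.eq_zero hb, insAssoc_zero_left b hA hC, insAssoc_zero_middle a b A hC, smul_zero]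
    · rw [insAssoc_comm_neg_one hB hA hC, mul_neg_one, Int.negOnePow_neg, smul_smul]
      rcases negOnePow_cases a with h | h <;> simp [h]
    first
    | (exfalso; push_cast at hn; omega)
    | have hBA := (hB.insAssoc hA hC).zsmul ((a * b).negOnePow : ℤˣ)
      rw [add_right_comm] at hBA
      refine (hA.insAssoc hB hC).ext_contract hBA (by omega) fun v => ?_
      have h := contract_insAssoc hB hA hC v
      rw [add_right_comm] at h
      push_cast at hn
      rw [contract_zsmul, h, contract_insAssoc hA hB hC,
        ih (hA.contract v) hB hC (by omega), ih hA (hB.contract v) hC (by omega),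
        ih hA hB (hC.contract v) (by omega), sub_one_mul, mul_sub_one, Int.negOnePow_sub,
        Int.negOnePow_sub]
      simp only [Units.val_mul]
      rcases negOnePow_cases a with h1 | h1 <;> rcases negOnePow_cases b with h2 | h2 <;>
        rw [h1, h2] <;> module

lemma nrBracket_eq (a b : ℤ) (A B : Op V) :
    nrBracket a b A B = -nrIns (ar b) (ar a) B A +
      (((a * b).negOnePow : ℤˣ) : ℤ) • nrIns (ar a) (ar b) A B := rfl

lemma IsAltOp.nrBracket {a b : ℤ} {A B : Op V} (hA : IsAltOp a A) (hB : IsAltOp b B) :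
    IsAltOp (a + b) (nrBracket a b A B) := by
  have h1 := (hB.nrIns hA).zsmul (-1)
  rw [add_comm b a, neg_one_smul] at h1
  exact h1.add ((hA.nrIns hB).zsmul _)

lemma nrBracket_comm (a b : ℤ) (A B : Op V) :
    nrBracket a b A B = -((((a * b).negOnePow : ℤˣ) : ℤ) • nrBracket b a B A) := by
  rw [nrBracket_eq, nrBracket_eq, mul_comm b a]
  rcases negOnePow_cases (a * b) with h | h <;> rw [h] <;> module

lemma nrIns_nrBracket_right {c : ℤ} {C : Op V} (hC : IsAltOp c C) (q : ℕ) (a b : ℤ)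
    (A B : Op V) :
    nrIns (ar c) q C (nrBracket a b A B) =
      -nrIns (ar c) q C (nrIns (ar b) (ar a) B A) +
        (((a * b).negOnePow : ℤˣ) : ℤ) • nrIns (ar c) q C (nrIns (ar a) (ar b) A B) := by
  rw [nrBracket_eq, ← neg_one_smul ℤ (nrIns (ar b) (ar a) B A), nrIns_add_right hC,
    nrIns_zsmul_right hC, nrIns_zsmul_right hC, neg_one_smul]

lemma nrIns_nrBracket_left (p q : ℕ) (a b : ℤ) (A B C : Op V) :
    nrIns p q (nrBracket a b A B) C =
      -nrIns p q (nrIns (ar b) (ar a) B A) C +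
        (((a * b).negOnePow : ℤˣ) : ℤ) • nrIns p q (nrIns (ar a) (ar b) A B) C := by
  rw [nrBracket_eq, ← neg_one_smul ℤ (nrIns (ar b) (ar a) B A), nrIns_add_left,
    nrIns_zsmul_left, nrIns_zsmul_left, neg_one_smul]

/-- The graded Jacobi identity for the Nijenhuis–Richardson bracket. -/
lemma nrBracket_jacobi {a b c : ℤ} {A B C : Op V} (hA : IsAltOp a A) (hB : IsAltOp b B)
    (hC : IsAltOp c C) :
    nrBracket (a + b) c (nrBracket a b A B) C =
      nrBracket a (b + c) A (nrBracket b c B C) -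
        (((a * b).negOnePow : ℤˣ) : ℤ) • nrBracket b (a + c) B (nrBracket a c A C) := by
  have h1 := insAssoc_comm hA hB hC
  have h2 := insAssoc_comm hB hC hA
  have h3 := insAssoc_comm hA hC hB
  simp only [insAssoc, add_comm c, add_comm b a] at h1 h2 h3
  rw [nrBracket_eq (a + b), nrBracket_eq a (b + c), nrBracket_eq b (a + c)]
  simp only [nrIns_nrBracket_left, nrIns_nrBracket_right hA, nrIns_nrBracket_right hB,
    nrIns_nrBracket_right hC, add_mul, mul_add, Int.negOnePow_add, Units.val_mul, mul_comm b a]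
  have hab := negOnePow_cases (a * b)
  have hac := negOnePow_cases (a * c)
  have hbc := negOnePow_cases (b * c)
  generalize (((a * b).negOnePow : ℤˣ) : ℤ) = x at *
  generalize (((a * c).negOnePow : ℤˣ) : ℤ) = y at *
  generalize (((b * c).negOnePow : ℤˣ) : ℤ) = z at *
  rcases hab with rfl | rfl <;> rcases hac with rfl | rfl <;> rcases hbc with rfl | rfl
  · linear_combination (norm := module) -h1 - h2 + h3
  · linear_combination (norm := module) -h1 - h2 - h3
  · linear_combination (norm := module) -h1 + h2 + h3
  · linear_combination (norm := module) -h1 + h2 - h3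
  · linear_combination (norm := module) -h1 + h2 + h3
  · linear_combination (norm := module) -h1 + h2 - h3
  · linear_combination (norm := module) -h1 - h2 + h3
  · linear_combination (norm := module) -h1 - h2 - h3

end AlternatingOperations

/-- The Nijenhuis–Richardson bracket makes `A(V)` a graded Lie
algebra: the insertion `i_B A` (hence the bracket) of alternating maps is
alternating, and graded skew-symmetry and the graded Jacobi identity hold. -/
theorem statement2 (k V : Type*) [Field k] [CharZero k]
    [AddCommGroup V] [Module k V]
    (a b c : ℤ) (ha : -1 ≤ a) (hb : -1 ≤ b) (hc : -1 ≤ c)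
    (A B C : Op V) (hA : MemA k a A) (hB : MemA k b B) (hC : MemA k c C) :
    IsAlternatingOn (ar (a + b)) (nrIns (ar a) (ar b) A B) ∧
    IsAlternatingOn (ar (a + b)) (nrBracket a b A B) ∧
    nrBracket a b A B = -((((-1 : ℤˣ) ^ (a * b) : ℤˣ) : ℤ) • nrBracket b a B A) ∧
    nrBracket (a + b) c (nrBracket a b A B) C =
      nrBracket a (b + c) A (nrBracket b c B C) -
        (((-1 : ℤˣ) ^ (a * b) : ℤˣ) : ℤ) • nrBracket b (a + c) B (nrBracket a c A C) := by
  have hA' := hA.isAltOp ha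
  have hB' := hB.isAltOp hb
  have hC' := hC.isAltOp hc
  exact ⟨(hA'.nrIns hB').alternating, (hA'.nrBracket hB').alternating, nrBracket_comm a b A B,
    nrBracket_jacobi hA' hB' hC'⟩

end JacobiRevisited
end
end

section
/- The first-order multidifferential operators form a graded associative subalgebra of (A(V),∧) and a graded Lie subalgebra of (A(V),[·,·]^{NR}): if A ∈ ADiff_1^a(V) and B ∈ ADiff_1^b(V) (a,b ≥ −1), then A∧B ∈ ADiff_1^{a+b+1}(V) and [A,B]^{NR} ∈ ADiff_1^{a+b}(V). -/
/-!  Common framework: operations of degree `a ≥ -1` on a vector space `V`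
(i.e. `(a+1)`-linear maps `V^{a+1} → V`) are encoded as raw functions
`(ℕ → V) → V` depending only on the first `a+1` entries of the argument
sequence, together with explicit multilinearity/alternation predicates. -/

noncomputable section
open scoped Classical

namespace JacobiRevisited

section Shuffles

open Equiv

/-- The permutation of `{0,…,p+q-1}` acting by `τ` on the first `p` positions and by `ρ` on the
remaining `q` positions. -/
def blockPerm {p q : ℕ} (τρ : Perm (Fin p) × Perm (Fin q)) : Perm (Fin (p + q)) :=
  finSumFinEquiv.permCongr (Perm.sumCongr τρ.1 τρ.2)

lemma blockPerm_castAdd {p q : ℕ} (τρ : Perm (Fin p) × Perm (Fin q)) (i : Fin p) :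
    blockPerm τρ (Fin.castAdd q i) = Fin.castAdd q (τρ.1 i) := by
  simp [blockPerm, Equiv.permCongr_apply]

lemma blockPerm_natAdd {p q : ℕ} (τρ : Perm (Fin p) × Perm (Fin q)) (j : Fin q) :
    blockPerm τρ (Fin.natAdd p j) = Fin.natAdd p (τρ.2 j) := by
  simp [blockPerm, Equiv.permCongr_apply]

lemma sign_blockPerm {p q : ℕ} (τρ : Perm (Fin p) × Perm (Fin q)) :
    Perm.sign (blockPerm τρ) = Perm.sign τρ.1 * Perm.sign τρ.2 := by
  rw [blockPerm, Perm.sign_permCongr, Perm.sign_sumCongr]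

lemma blockPerm_injective {p q : ℕ} :
    Function.Injective (blockPerm : Perm (Fin p) × Perm (Fin q) → Perm (Fin (p + q))) :=
  finSumFinEquiv.permCongr.injective.comp Perm.sumCongrHom_injective

lemma le_blockPerm_iff {p q : ℕ} (τρ : Perm (Fin p) × Perm (Fin q)) (i : Fin (p + q)) :
    p ≤ (blockPerm τρ i : ℕ) ↔ p ≤ (i : ℕ) := by
  induction i using Fin.addCases with
  | left i => simp only [blockPerm_castAdd, Fin.val_castAdd]; omega
  | right j => simp [blockPerm_natAdd]

lemma exists_blockPerm_eq {p q : ℕ} {π : Perm (Fin (p + q))}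
    (hπ : ∀ i, p ≤ (π i : ℕ) ↔ p ≤ (i : ℕ)) :
    ∃ τρ : Perm (Fin p) × Perm (Fin q), blockPerm τρ = π := by
  have hmaps : Set.MapsTo (finSumFinEquiv.symm.permCongr π)
      (Set.range (Sum.inl : Fin p → Fin p ⊕ Fin q)) (Set.range Sum.inl) := by
    rintro _ ⟨i, rfl⟩
    have hi : ((π (Fin.castAdd q i) : Fin (p + q)) : ℕ) < p := by
      have := hπ (Fin.castAdd q i)
      simp only [Fin.val_castAdd] at this
      omega
    refine ⟨⟨_, hi⟩, ?_⟩
    rw [Equiv.permCongr_apply, Equiv.symm_symm, finSumFinEquiv_apply_left, Equiv.eq_symm_apply,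
      finSumFinEquiv_apply_left]
    rfl
  obtain ⟨τρ, h⟩ := Perm.mem_sumCongrHom_range_of_perm_mapsTo_inl hmaps
  refine ⟨τρ, ?_⟩
  have h' : Perm.sumCongr τρ.1 τρ.2 = finSumFinEquiv.symm.permCongr π := h
  rw [blockPerm, h']
  ext i
  simp [Equiv.permCongr_apply]

/-- Positions of a permutation, ordered by block first and then by value; `σ` is an unshuffle
exactly when this function is monotone. -/
def blockKey (p : ℕ) {n : ℕ} (σ : Perm (Fin n)) (i : Fin n) : Bool ×ₗ Fin n :=
  toLex (decide (p ≤ (i : ℕ)), σ i)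

lemma blockKey_injective (p : ℕ) {n : ℕ} (σ : Perm (Fin n)) :
    Function.Injective (blockKey p σ) := fun i j h => by
  simpa [blockKey] using congrArg (fun z => (ofLex z).2) h

lemma mem_unshuffles_iff {n p : ℕ} {σ : Perm (Fin n)} :
    σ ∈ Unshuffles n p ↔ Monotone (blockKey p σ) := by
  simp only [Unshuffles, Finset.mem_filter, Finset.mem_univ, true_and]
  constructor
  · rintro ⟨h₁, h₂⟩ i j hij
    rcases hij.eq_or_lt with rfl | hij
    · rfl
    have hij' : (i : ℕ) < j := hij
    rw [blockKey, blockKey, Prod.Lex.toLex_le_toLex]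
    by_cases hi : p ≤ (i : ℕ)
    · have hj : p ≤ (j : ℕ) := by omega
      right
      simpa [hi, hj] using (h₂ i j hij hi).le
    · by_cases hj : p ≤ (j : ℕ)
      · left; simp [hi, hj]
      · right
        simpa [hi, hj] using (h₁ i j hij (by omega)).le
  · intro h
    have key : ∀ i j : Fin n, (i : ℕ) < j → (p ≤ (i : ℕ) ↔ p ≤ (j : ℕ)) → σ i < σ j := by
      intro i j hij hp
      have := h (show i ≤ j from hij.le)
      rw [blockKey, blockKey, Prod.Lex.toLex_le_toLex] at this
      rcases this with h | ⟨-, h⟩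
      · simp [hp] at h
      · exact lt_of_le_of_ne h fun e => by
          have := congrArg Fin.val (σ.injective e)
          omega
    exact ⟨fun i j hij hj => key i j hij (by omega), fun i j hij hi => key i j hij (by omega)⟩

lemma blockKey_mul_comp_inv {p q : ℕ} (σ : Perm (Fin (p + q)))
    (τρ : Perm (Fin p) × Perm (Fin q)) :
    blockKey p (σ * blockPerm τρ) ∘ ⇑(blockPerm τρ)⁻¹ = blockKey p σ := by
  funext i
  have h := le_blockPerm_iff τρ ((blockPerm τρ)⁻¹ i)
  rw [show blockPerm τρ ((blockPerm τρ)⁻¹ i) = i from Equiv.apply_symm_apply _ _] at h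
  simp [blockKey, h]

lemma unshuffles_mul_blockPerm_injOn {p q : ℕ} {σ σ' : Perm (Fin (p + q))}
    {τρ τρ' : Perm (Fin p) × Perm (Fin q)} (hσ : σ ∈ Unshuffles (p + q) p)
    (hσ' : σ' ∈ Unshuffles (p + q) p) (h : σ * blockPerm τρ = σ' * blockPerm τρ') :
    σ = σ' ∧ τρ = τρ' := by
  rw [mem_unshuffles_iff] at hσ hσ'
  rw [← blockKey_mul_comp_inv σ τρ, h] at hσ
  rw [← blockKey_mul_comp_inv σ' τρ'] at hσ'
  have hb := Tuple.unique_monotone hσ hσ'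
  have hinv : blockPerm τρ = blockPerm τρ' := inv_injective <| Equiv.ext fun i =>
    blockKey_injective _ _ (congrFun hb i)
  rw [hinv] at h
  exact ⟨mul_right_cancel h, blockPerm_injective hinv⟩

lemma exists_unshuffle_mul_blockPerm {p q : ℕ} (π : Perm (Fin (p + q))) :
    ∃ σ ∈ Unshuffles (p + q) p, ∃ τρ : Perm (Fin p) × Perm (Fin q), σ * blockPerm τρ = π := by
  set s := Tuple.sort (blockKey p π)
  have hs : Monotone (blockKey p π ∘ s) := Tuple.monotone_sort _
  set blk : Fin (p + q) → Bool := fun i => decide (p ≤ (i : ℕ))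
  have hblk : Monotone blk := fun i j hij => by
    have hij' : (i : ℕ) ≤ j := hij
    simp only [blk, Bool.le_iff_imp, decide_eq_true_eq]
    omega
  have hmono : Monotone (blk ∘ s) := fun i j hij =>
    Prod.Lex.monotone_fst _ _ (hs hij)
  have heq := Tuple.unique_monotone (τ := 1) hmono hblk
  obtain ⟨τρ, hτρ⟩ := exists_blockPerm_eq (π := s⁻¹) (fun i => by
    have := congrFun heq (s⁻¹ i)
    simpa [blk] using this.symm)
  refine ⟨π * s, ?_, τρ, by rw [hτρ, mul_inv_cancel_right]⟩
  rw [mem_unshuffles_iff, ← blockKey_mul_comp_inv _ τρ, hτρ, mul_inv_cancel_right, inv_inv]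
  exact hs

lemma sum_perm_eq_card_nsmul_sum_unshuffles {V : Type*} [AddCommMonoid V] {p q : ℕ}
    (F : Perm (Fin (p + q)) → V) (hF : ∀ σ τρ, F (σ * blockPerm τρ) = F σ) :
    ∑ π, F π =
      Fintype.card (Perm (Fin p) × Perm (Fin q)) • ∑ σ ∈ Unshuffles (p + q) p, F σ := by
  calc ∑ π, F π
      = ∑ z ∈ Unshuffles (p + q) p ×ˢ
          (Finset.univ : Finset (Perm (Fin p) × Perm (Fin q))), F z.1 := by
        symm
        refine Finset.sum_bij (fun z _ => z.1 * blockPerm z.2) (fun _ _ => Finset.mem_univ _)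
          ?_ ?_ (fun z _ => (hF _ _).symm)
        · intro z hz w hw h
          have := unshuffles_mul_blockPerm_injOn (Finset.mem_product.1 hz).1
            (Finset.mem_product.1 hw).1 h
          exact Prod.ext this.1 this.2
        · intro π _
          obtain ⟨σ, hσ, τρ, h⟩ := exists_unshuffle_mul_blockPerm π
          exact ⟨(σ, τρ), by simp [hσ], h⟩
    _ = _ := by
        rw [Finset.sum_product]
        simp [Finset.sum_nsmul, Finset.card_univ]

end Shuffles

section ShuffleSum

open Equiv

lemma update_block {n : ℕ} {ι W : Type*} [DecidableEq ι] (σ : Perm (Fin n)) {e : ι → Fin n}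
    (he : Function.Injective e) (x : ℕ → W) (v : W) (i : ι) :
    (fun l => Function.update x (σ (e i) : ℕ) v (σ (e l))) =
      Function.update (fun l => x (σ (e l))) i v :=
  Function.update_comp_eq_of_injective' x
    (Fin.val_injective.comp (σ.injective.comp he)) i v

lemma update_block_of_ne {n : ℕ} {ι W : Type*} (σ : Perm (Fin n)) {e : ι → Fin n}
    (x : ℕ → W) (v : W) {t : Fin n} (ht : ∀ l, e l ≠ t) :
    (fun l => Function.update x (σ t : ℕ) v (σ (e l))) = fun l => x (σ (e l)) :=
  Function.update_comp_eq_of_forall_ne' x v fun l hl =>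
    ht l (σ.injective (Fin.val_injective hl))

variable {k V : Type*} [Field k] [CommRing V] [Algebra k V]

/-- The signed sum of `Φ` over all ways to distribute the first `n = p + q` arguments in order over
the `p` outer and the `q` inner slots of `Φ`. -/
def shuffleSum (n p q : ℕ) (h : p + q = n) (Φ : V [⋀^Fin p]→ₗ[k] (V [⋀^Fin q]→ₗ[k] V)) : Op V :=
  fun x => ∑ σ ∈ Unshuffles n p, ((Perm.sign σ : ℤˣ) : ℤ) •
    Φ (fun i => x (σ ⟨i, by omega⟩)) (fun j => x (σ ⟨p + j, by omega⟩))

lemma shuffleSum_alternating [CharZero k] (n p q : ℕ) (h : p + q = n)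
    (Φ : V [⋀^Fin p]→ₗ[k] (V [⋀^Fin q]→ₗ[k] V)) :
    IsAlternatingOn n (shuffleSum n p q h Φ) := by
  subst h
  intro x i j hi hj hij hx
  have : Module ℚ V := Module.compHom V (algebraMap ℚ k)
  have : IsAddTorsionFree V := .of_module_rat V
  have hnz : Fintype.card (Perm (Fin p) × Perm (Fin q)) ≠ 0 := Fintype.card_ne_zero
  let F : Perm (Fin (p + q)) → V := fun σ => ((Perm.sign σ : ℤˣ) : ℤ) •
    Φ (fun i => x (σ (Fin.castAdd q i))) (fun j => x (σ (Fin.natAdd p j)))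
  have hF : ∀ σ τρ, F (σ * blockPerm τρ) = F σ := by
    intro σ τρ
    have h₁ := Φ.map_perm (fun i => x (σ (Fin.castAdd q i))) τρ.1
    have h₂ := (Φ (fun i => x (σ (Fin.castAdd q i)))).map_perm
      (fun j => x (σ (Fin.natAdd p j))) τρ.2
    simp only [Function.comp_def] at h₁ h₂
    simp only [F, Perm.mul_apply, blockPerm_castAdd, blockPerm_natAdd, h₁, h₂,
      Perm.sign_mul, sign_blockPerm, AlternatingMap.smul_apply, Units.smul_def, smul_smul,
      Units.val_mul]
    congr 1
    have e₁ := Int.units_mul_self (Perm.sign τρ.1)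
    have e₂ := Int.units_mul_self (Perm.sign τρ.2)
    rw [← Units.val_inj, Units.val_mul, Units.val_one] at e₁ e₂
    linear_combination
      ((Perm.sign σ : ℤˣ) : ℤ) * (((Perm.sign τρ.2 : ℤˣ) : ℤ) * ((Perm.sign τρ.2 : ℤˣ) : ℤ)) * e₁
        + ((Perm.sign σ : ℤˣ) : ℤ) * e₂
  have hzero : ∑ π, F π = 0 := by
    have hne : (⟨i, hi⟩ : Fin (p + q)) ≠ ⟨j, hj⟩ := by simpa using hij
    have hswap : ∀ l : Fin (p + q), x (swap (⟨i, hi⟩ : Fin (p + q)) ⟨j, hj⟩ l) = x l := by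
      intro l
      by_cases h₁ : l = ⟨i, hi⟩
      · subst h₁; simp [hx]
      by_cases h₂ : l = ⟨j, hj⟩
      · subst h₂; simp [hx]
      rw [swap_apply_of_ne_of_ne h₁ h₂]
    have hneg : ∑ π, F π = -∑ π, F π := by
      rw [← Finset.sum_neg_distrib,
        ← Equiv.sum_comp (Equiv.mulLeft (swap (⟨i, hi⟩ : Fin (p + q)) ⟨j, hj⟩)) F]
      refine Finset.sum_congr rfl fun π _ => ?_
      simp [F, hswap, Perm.sign_mul, Perm.sign_swap hne]
    exact self_eq_neg.1 hneg
  rw [sum_perm_eq_card_nsmul_sum_unshuffles F hF] at hzero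
  exact (smul_eq_zero.1 hzero).resolve_left hnz

/-- A slot of an unshuffle sum is fed to exactly one of the two blocks. -/
lemma block_cases {n p q : ℕ} (h : p + q = n) (t : Fin n) :
    (∃ i : Fin p, t = ⟨i, by omega⟩) ∨ ∃ j : Fin q, t = ⟨p + j, by omega⟩ := by
  by_cases ht : (t : ℕ) < p
  · exact .inl ⟨⟨t, ht⟩, rfl⟩
  · exact .inr ⟨⟨t - p, by omega⟩, by ext; simp; omega⟩

/-- The dependence of one summand of a shuffle sum on a single argument. -/
lemma shuffle_term_update {n p q : ℕ} (h : p + q = n)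
    (Φ : V [⋀^Fin p]→ₗ[k] (V [⋀^Fin q]→ₗ[k] V)) (x : ℕ → V) (σ : Perm (Fin n)) (t : Fin n) :
    (∃ i : Fin p, t = ⟨i, by omega⟩ ∧ ∀ v,
      Φ (fun i => Function.update x (σ t : ℕ) v (σ ⟨i, by omega⟩))
        (fun j => Function.update x (σ t : ℕ) v (σ ⟨p + j, by omega⟩)) =
      Φ (Function.update (fun i => x (σ ⟨i, by omega⟩)) i v) (fun j => x (σ ⟨p + j, by omega⟩))) ∨
    (∃ j : Fin q, t = ⟨p + j, by omega⟩ ∧ ∀ v,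
      Φ (fun i => Function.update x (σ t : ℕ) v (σ ⟨i, by omega⟩))
        (fun j => Function.update x (σ t : ℕ) v (σ ⟨p + j, by omega⟩)) =
      Φ (fun i => x (σ ⟨i, by omega⟩)) (Function.update (fun j => x (σ ⟨p + j, by omega⟩)) j v)) := by
  have he₁ : Function.Injective (fun i : Fin p => (⟨i, by omega⟩ : Fin n)) := fun a b hab => by
    simpa [Fin.ext_iff] using hab
  have he₂ : Function.Injective (fun j : Fin q => (⟨p + j, by omega⟩ : Fin n)) := fun a b hab => by
    simpa [Fin.ext_iff] using hab
  rcases block_cases h t with ⟨i, rfl⟩ | ⟨j, rfl⟩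
  · refine .inl ⟨i, rfl, fun v => ?_⟩
    rw [update_block σ he₁, update_block_of_ne σ (e := fun j : Fin q => ⟨p + j, by omega⟩)]
    intro l hl
    have := congrArg Fin.val hl
    simp at this
    omega
  · refine .inr ⟨j, rfl, fun v => ?_⟩
    rw [update_block σ he₂, update_block_of_ne σ (e := fun i : Fin p => ⟨i, by omega⟩)]
    intro l hl
    have := congrArg Fin.val hl
    simp at this
    omega

lemma shuffleSum_multilinear (n p q : ℕ) (h : p + q = n)
    (Φ : V [⋀^Fin p]→ₗ[k] (V [⋀^Fin q]→ₗ[k] V)) :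
    IsMultilinearOn k n (shuffleSum n p q h Φ) := by
  refine ⟨fun x y hxy => ?_, fun i hi => ⟨fun x c v => ?_, fun x v w => ?_⟩⟩
  · simp only [shuffleSum, fun l : Fin n => hxy l l.2]
  · simp only [shuffleSum, Finset.smul_sum]
    refine Finset.sum_congr rfl fun σ _ => ?_
    rw [smul_comm]
    congr 1
    have hs : i = ((σ (σ.symm ⟨i, hi⟩) : Fin n) : ℕ) := by simp
    rw [hs]
    rcases shuffle_term_update h Φ x σ (σ.symm ⟨i, hi⟩) with ⟨i, -, hv⟩ | ⟨j, -, hv⟩ <;>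
      simp only [hv, AlternatingMap.map_update_smul, AlternatingMap.smul_apply]
  · simp only [shuffleSum, ← Finset.sum_add_distrib]
    refine Finset.sum_congr rfl fun σ _ => ?_
    rw [← smul_add]
    congr 1
    have hs : i = ((σ (σ.symm ⟨i, hi⟩) : Fin n) : ℕ) := by simp
    rw [hs]
    rcases shuffle_term_update h Φ x σ (σ.symm ⟨i, hi⟩) with ⟨i, -, hv⟩ | ⟨j, -, hv⟩ <;>
      simp only [hv, AlternatingMap.map_update_add, AlternatingMap.add_apply]

end ShuffleSum

section FirstOrder

variable {k V : Type*} [Field k] [CommRing V] [Algebra k V]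

/-- The obstruction for `T` to be a differential operator of order at most one. -/
def firstOrderDefect (T : V → V) (f g : V) : V :=
  T (f * g) - f * T g - g * T f + f * g * T 1

lemma firstOrderDefect_zsmul (c : ℤ) (T : V → V) (f g : V) :
    firstOrderDefect (fun v => c • T v) f g = c • firstOrderDefect T f g := by
  simp only [firstOrderDefect, zsmul_eq_mul]
  ring

lemma firstOrderDefect_sum {ι : Type*} (s : Finset ι) (T : ι → V → V) (f g : V) :
    firstOrderDefect (fun v => ∑ i ∈ s, T i v) f g = ∑ i ∈ s, firstOrderDefect (T i) f g := by
  simp only [firstOrderDefect, Finset.mul_sum, Finset.sum_sub_distrib, Finset.sum_add_distrib]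

/-- The part of a first-order operator killing constants. -/
def derivationPart (T : V → V) (f : V) : V := T f - f * T 1

lemma firstOrderDefect_comp {P Q : V → V} (hadd : ∀ u v, P (u + v) = P u + P v)
    (hneg : ∀ u, P (-u) = -P u) (hP : ∀ f g, firstOrderDefect P f g = 0)
    (hQ : ∀ f g, firstOrderDefect Q f g = 0) (f g : V) :
    firstOrderDefect (fun v => P (Q v)) f g =
      derivationPart P f * derivationPart Q g + derivationPart P g * derivationPart Q f := by
  have hP' : ∀ f g, P (f * g) = f * P g + g * P f - f * g * P 1 := fun f g => by
    have := hP f g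
    rw [firstOrderDefect] at this
    linear_combination this
  have hQ' : Q (f * g) = f * Q g + g * Q f + -(f * g * Q 1) := by
    have := hQ f g
    rw [firstOrderDefect] at this
    linear_combination this
  simp only [firstOrderDefect, derivationPart]
  rw [hQ', hadd, hadd, hneg, hP' f (Q g), hP' g (Q f), hP' (f * g) (Q 1), hP' f g]
  ring

/-- An alternating map which is a first-order differential operator in each slot. -/
def IsFirstOrder {n : ℕ} (A : V [⋀^Fin n]→ₗ[k] V) : Prop :=
  ∀ (i : Fin n) (u : Fin n → V) (f g : V),
    firstOrderDefect (fun v => A (Function.update u i v)) f g = 0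

lemma ar_natCast_sub_one (n : ℕ) : ar ((n : ℤ) - 1) = n := by
  simp [ar]

lemma consV_eq_update (v : V) (x : ℕ → V) : consV v x = Function.update (consV 0 x) 0 v := by
  funext n
  by_cases h : n = 0 <;> simp [consV, h]

lemma MemADiff1.exists_alternatingMap {n : ℕ} {A : Op V} (hA : MemADiff1 k ((n : ℤ) - 1) A) :
    ∃ A' : V [⋀^Fin n]→ₗ[k] V, (∀ x : ℕ → V, A x = A' fun i => x i) ∧ IsFirstOrder A' := by
  obtain ⟨⟨hdep, hlin⟩, halt, hfo⟩ := hA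
  rw [ar_natCast_sub_one] at hdep hlin halt
  let ext : (Fin n → V) → ℕ → V := fun y i => if h : i < n then y ⟨i, h⟩ else 0
  have hext : ∀ (y : Fin n → V) (i : Fin n) (v : V),
      ext (Function.update y i v) = Function.update (ext y) i v := by
    intro y i v
    funext j
    by_cases hj : j < n
    · by_cases hji : j = i
      · subst hji; simp [ext]
      · have : (⟨j, hj⟩ : Fin n) ≠ i := fun h => hji (congrArg Fin.val h)
        simp [ext, hj, Function.update_of_ne hji, Function.update_of_ne this]
    · have : j ≠ i := by omega
      simp [ext, hj, Function.update_of_ne this]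
  have hext' : ∀ (y : Fin n → V) (i : Fin n), ext y i = y i := fun y i => by simp [ext]
  let A' : V [⋀^Fin n]→ₗ[k] V :=
    { toFun := fun y => A (ext y)
      map_update_add' := fun {inst} y i v w => by
        obtain rfl : inst = instDecidableEqFin n := Subsingleton.elim _ _
        simp only [hext]
        exact (hlin i i.2).2 _ v w
      map_update_smul' := fun {inst} y i c v => by
        obtain rfl : inst = instDecidableEqFin n := Subsingleton.elim _ _
        simp only [hext]
        exact (hlin i i.2).1 _ c v
      map_eq_zero_of_eq' := fun y i j hy hij =>
        halt _ i j i.2 j.2 (by simpa [Fin.ext_iff] using hij) (by simpa [hext'] using hy) }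
  have hA' : ∀ x : ℕ → V, A x = A' fun i => x i := fun x =>
    hdep _ _ fun i hi => by simp [ext, hi]
  refine ⟨A', hA', fun i u f g => ?_⟩
  obtain ⟨m, rfl⟩ : ∃ m, n = m + 1 := ⟨n - 1, by have := i.2; omega⟩
  have hslot : ∀ v, A' (Function.update u i v) = ((Equiv.Perm.sign (Equiv.swap 0 i) : ℤˣ) : ℤ) •
      A (consV v fun j => ext (u ∘ Equiv.swap 0 i) (j + 1)) := by
    intro v
    rw [hA', ← Units.smul_def, ← AlternatingMap.map_perm]
    congr 1
    funext j
    simp only [Function.comp_apply, consV, Function.update_apply]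
    by_cases hj : j = i
    · subst hj; simp
    · have hne : Equiv.swap 0 i j ≠ 0 := fun h => hj <| by
        simpa using (Equiv.swap_apply_eq_iff.1 h)
      have hne' : ((Equiv.swap 0 i j : Fin (m + 1)) : ℕ) ≠ 0 := fun h => hne (Fin.ext h)
      rw [if_neg hj, if_neg hne', Nat.sub_add_cancel (by omega), hext']
      simp
  simp only [hslot]
  rw [firstOrderDefect_zsmul, firstOrderDefect, hfo (by push_cast; omega), zsmul_eq_mul]
  ring

/-- The bilinear pairing of the blocks underlying `nrIns`. -/
def insertionForm {m q : ℕ} (A : V [⋀^Fin (m + 1)]→ₗ[k] V) (B : V [⋀^Fin q]→ₗ[k] V) :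
    V [⋀^Fin q]→ₗ[k] (V [⋀^Fin m]→ₗ[k] V) :=
  A.curryLeft.compAlternatingMap B

/-- The bilinear pairing of the blocks underlying `wedge`. -/
def wedgeForm {p q : ℕ} (A : V [⋀^Fin p]→ₗ[k] V) (B : V [⋀^Fin q]→ₗ[k] V) :
    V [⋀^Fin p]→ₗ[k] (V [⋀^Fin q]→ₗ[k] V) :=
  LinearMap.compAlternatingMap
    { toFun := fun c => c • B
      map_add' := fun c d => add_smul c d B
      map_smul' := fun r c => AlternatingMap.ext fun _ => smul_assoc r c _ } A

lemma insertionForm_apply {m q : ℕ} (A : V [⋀^Fin (m + 1)]→ₗ[k] V) (B : V [⋀^Fin q]→ₗ[k] V)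
    (u : Fin q → V) (w : Fin m → V) :
    insertionForm A B u w = A (Fin.cons (B u) w) := rfl

lemma wedgeForm_apply {p q : ℕ} (A : V [⋀^Fin p]→ₗ[k] V) (B : V [⋀^Fin q]→ₗ[k] V)
    (u : Fin p → V) (w : Fin q → V) : wedgeForm A B u w = A u * B w := rfl

lemma wedge_eq_shuffleSum {p q : ℕ} {A B : Op V} {A' : V [⋀^Fin p]→ₗ[k] V}
    {B' : V [⋀^Fin q]→ₗ[k] V} (hA : ∀ x : ℕ → V, A x = A' fun i => x i)
    (hB : ∀ x : ℕ → V, B x = B' fun i => x i) :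
    wedge p q A B = shuffleSum (p + q) p q rfl (wedgeForm A' B') := by
  funext x
  simp [wedge, shuffleSum, wedgeForm_apply, hA, hB]

lemma nrIns_eq_shuffleSum {m q n : ℕ} (h : q + m = n) {A B : Op V}
    {A' : V [⋀^Fin (m + 1)]→ₗ[k] V} {B' : V [⋀^Fin q]→ₗ[k] V}
    (hA : ∀ x : ℕ → V, A x = A' fun i => x i) (hB : ∀ x : ℕ → V, B x = B' fun i => x i) :
    nrIns (m + 1) q A B = shuffleSum n q m h (insertionForm A' B') := by
  obtain rfl : m + 1 + q - 1 = n := by omega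
  funext x
  rw [nrIns, dif_neg (Nat.succ_ne_zero m)]
  refine Finset.sum_congr rfl fun σ _ => ?_
  rw [insertionForm_apply, hA]
  congr 2
  funext j
  induction j using Fin.cases with
  | zero => simp [hB]
  | succ j => simp [← add_assoc]

lemma IsMultilinearOn.zero (n : ℕ) : IsMultilinearOn k n (0 : Op V) :=
  ⟨fun _ _ _ => rfl, fun _ _ => ⟨fun _ _ _ => by simp, fun _ _ _ => by simp⟩⟩

lemma nrIns_mem_alternating [CharZero k] {p q n : ℕ} (hn : p + q - 1 = n) {A B : Op V}
    {A' : V [⋀^Fin p]→ₗ[k] V} {B' : V [⋀^Fin q]→ₗ[k] V}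
    (hA : ∀ x : ℕ → V, A x = A' fun i => x i) (hB : ∀ x : ℕ → V, B x = B' fun i => x i) :
    IsMultilinearOn k n (nrIns p q A B) ∧ IsAlternatingOn n (nrIns p q A B) := by
  cases p with
  | zero =>
    have : nrIns 0 q A B = 0 := by funext x; simp [nrIns]
    rw [this]
    exact ⟨.zero n, fun _ _ _ _ _ _ _ => rfl⟩
  | succ m =>
    rw [nrIns_eq_shuffleSum (show q + m = n by omega) hA hB]
    exact ⟨shuffleSum_multilinear .., shuffleSum_alternating _ _ _ _ _⟩

lemma nrBracket_mem_alternating [CharZero k] {p q n : ℕ} (hn : p + q - 1 = n) {A B : Op V}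
    {A' : V [⋀^Fin p]→ₗ[k] V} {B' : V [⋀^Fin q]→ₗ[k] V}
    (hA : ∀ x : ℕ → V, A x = A' fun i => x i) (hB : ∀ x : ℕ → V, B x = B' fun i => x i) :
    IsMultilinearOn k n (nrBracket ((p : ℤ) - 1) ((q : ℤ) - 1) A B) ∧
      IsAlternatingOn n (nrBracket ((p : ℤ) - 1) ((q : ℤ) - 1) A B) := by
  obtain ⟨⟨d₁, l₁⟩, a₁⟩ := nrIns_mem_alternating (show q + p - 1 = n by omega) hB hA
  obtain ⟨⟨d₂, l₂⟩, a₂⟩ := nrIns_mem_alternating hn hA hB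
  simp only [nrBracket, ar_natCast_sub_one]
  refine ⟨⟨fun x y hxy => ?_, fun i hi => ⟨fun x c v => ?_, fun x v w => ?_⟩⟩,
    fun x i j hi hj hij hx => ?_⟩
  · simp only [Pi.add_apply, Pi.neg_apply, Pi.smul_apply, d₁ x y hxy, d₂ x y hxy]
  · simp only [Pi.add_apply, Pi.neg_apply, Pi.smul_apply, (l₁ i hi).1, (l₂ i hi).1, smul_add,
      smul_neg]
    rw [smul_comm]
  · simp only [Pi.add_apply, Pi.neg_apply, Pi.smul_apply, (l₁ i hi).2, (l₂ i hi).2, smul_add]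
    abel
  · simp [a₁ x i j hi hj hij hx, a₂ x i j hi hj hij hx]

lemma firstOrderDefect_wedge {p q N : ℕ} (h : p + q = N + 1) {A : V [⋀^Fin p]→ₗ[k] V}
    {B : V [⋀^Fin q]→ₗ[k] V} (hA : IsFirstOrder A) (hB : IsFirstOrder B) (x : ℕ → V) (f g : V) :
    firstOrderDefect (fun v => shuffleSum (N + 1) p q h (wedgeForm A B) (consV v x)) f g = 0 := by
  simp only [shuffleSum, firstOrderDefect_sum, firstOrderDefect_zsmul]
  refine Finset.sum_eq_zero fun σ _ => ?_
  have hc := fun v : V => consV_eq_update v x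
  generalize consV (0 : V) x = y at hc
  simp only [hc]
  have h0 : (0 : ℕ) = ((σ (σ.symm 0) : Fin (N + 1)) : ℕ) := by simp
  rw [h0]
  rcases shuffle_term_update h (wedgeForm A B) y σ (σ.symm 0) with
    ⟨i, -, hv⟩ | ⟨j, -, hv⟩
  · simp only [hv, wedgeForm_apply]
    have := hA i (fun i => y (σ ⟨i, by omega⟩)) f g
    simp only [firstOrderDefect] at this ⊢
    linear_combination (((Equiv.Perm.sign σ : ℤˣ) : ℤ) : V) *
      B (fun j => y (σ ⟨p + j, by omega⟩)) * this
  · simp only [hv, wedgeForm_apply]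
    have := hB j (fun j => y (σ ⟨p + j, by omega⟩)) f g
    simp only [firstOrderDefect] at this ⊢
    linear_combination (((Equiv.Perm.sign σ : ℤˣ) : ℤ) : V) *
      A (fun i => y (σ ⟨i, by omega⟩)) * this

lemma firstOrderDefect_insertion_term_right {m q N : ℕ} (h : q + m = N + 1)
    {A : V [⋀^Fin (m + 1)]→ₗ[k] V} (B : V [⋀^Fin q]→ₗ[k] V) (hA : IsFirstOrder A) (x : ℕ → V)
    (σ : Equiv.Perm (Fin (N + 1))) (hσ : q ≤ (σ.symm 0 : ℕ)) (f g : V) :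
    firstOrderDefect (fun v => insertionForm A B (fun i => consV v x (σ ⟨i, by omega⟩))
      (fun j => consV v x (σ ⟨q + j, by omega⟩))) f g = 0 := by
  have hc := fun v : V => consV_eq_update v x
  generalize consV (0 : V) x = y at hc
  simp only [hc]
  have h0 : (0 : ℕ) = ((σ (σ.symm 0) : Fin (N + 1)) : ℕ) := by simp
  rw [h0]
  rcases shuffle_term_update h (insertionForm A B) y σ (σ.symm 0) with ⟨i, hi, -⟩ | ⟨j, -, hv⟩
  · rw [hi] at hσ
    exact absurd i.2 (not_lt.2 hσ)
  · simp only [hv, insertionForm_apply, Fin.cons_update]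
    exact hA _ _ f g

lemma firstOrderDefect_insertion_const {m N : ℕ} (h : 0 + m = N + 1)
    {A : V [⋀^Fin (m + 1)]→ₗ[k] V} (B : V [⋀^Fin 0]→ₗ[k] V) (hA : IsFirstOrder A) (x : ℕ → V)
    (f g : V) :
    firstOrderDefect (fun v => shuffleSum (N + 1) 0 m h (insertionForm A B) (consV v x)) f g
      = 0 := by
  simp only [shuffleSum, firstOrderDefect_sum, firstOrderDefect_zsmul]
  refine Finset.sum_eq_zero fun σ _ => ?_
  rw [firstOrderDefect_insertion_term_right h B hA x σ (Nat.zero_le _), smul_zero]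

/-- The unshuffles whose first block starts with the first argument. -/
def pointedUnshuffles (N p : ℕ) : Finset (Equiv.Perm (Fin (N + 1))) :=
  (Unshuffles (N + 1) p).filter fun σ => σ 0 = 0

/-- The product of the derivation parts of `A` and `B` in their first slots. -/
def derivationCross {m l : ℕ} (A : V [⋀^Fin (m + 1)]→ₗ[k] V) (B : V [⋀^Fin (l + 1)]→ₗ[k] V)
    (f g : V) (w : Fin m → V) (u : Fin l → V) : V :=
  derivationPart (fun v => A (Fin.cons v w)) f * derivationPart (fun v => B (Fin.cons v u)) g

lemma IsFirstOrder.cons {m : ℕ} {A : V [⋀^Fin (m + 1)]→ₗ[k] V} (hA : IsFirstOrder A)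
    (w : Fin m → V) (f g : V) : firstOrderDefect (fun v => A (Fin.cons v w)) f g = 0 := by
  simpa only [Fin.update_cons_zero] using hA 0 (Fin.cons 0 w) f g

lemma firstOrderDefect_insertion {m l N : ℕ} (h : l + 1 + m = N + 1)
    {A : V [⋀^Fin (m + 1)]→ₗ[k] V} {B : V [⋀^Fin (l + 1)]→ₗ[k] V} (hA : IsFirstOrder A)
    (hB : IsFirstOrder B) (x : ℕ → V) (f g : V) :
    firstOrderDefect (fun v => shuffleSum (N + 1) (l + 1) m h (insertionForm A B) (consV v x)) f g =
      ∑ σ ∈ pointedUnshuffles N (l + 1), ((Equiv.Perm.sign σ : ℤˣ) : ℤ) •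
        (derivationCross A B f g (fun j => x (σ ⟨l + 1 + j, by omega⟩ - 1))
            (fun i => x (σ ⟨1 + i, by omega⟩ - 1)) +
          derivationCross A B g f (fun j => x (σ ⟨l + 1 + j, by omega⟩ - 1))
            (fun i => x (σ ⟨1 + i, by omega⟩ - 1))) := by
  simp only [shuffleSum, firstOrderDefect_sum, firstOrderDefect_zsmul]
  rw [pointedUnshuffles, Finset.sum_filter]
  refine Finset.sum_congr rfl fun σ hσ => ?_
  split_ifs with h0
  · congr 1
    have hne : ∀ (t : ℕ) (ht : t < N + 1), t ≠ 0 → ((σ ⟨t, ht⟩ : Fin (N + 1)) : ℕ) ≠ 0 := by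
      intro t ht ht0 hz
      have := σ.injective ((Fin.ext hz : σ ⟨t, ht⟩ = 0).trans h0.symm)
      exact ht0 (congrArg Fin.val this)
    have hu : ∀ v, (fun i : Fin (l + 1) => consV v x (σ ⟨i, by omega⟩)) =
        Fin.cons v (fun i : Fin l => x (σ ⟨1 + i, by omega⟩ - 1)) := by
      intro v
      funext i
      induction i using Fin.cases with
      | zero =>
        have : ((σ ⟨0, by omega⟩ : Fin (N + 1)) : ℕ) = 0 := congrArg Fin.val h0
        simp [consV, h0]
      | succ i =>
        have := hne (1 + i) (by omega) (by omega)
        simp only [Fin.val_succ, Fin.cons_succ, consV, add_comm (i : ℕ) 1, if_neg this]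
    have hw : ∀ v, (fun j : Fin m => consV v x (σ ⟨l + 1 + j, by omega⟩)) =
        fun j : Fin m => x (σ ⟨l + 1 + j, by omega⟩ - 1) := by
      intro v
      funext j
      rw [consV, if_neg (hne _ _ (by omega))]
    simp only [hu, hw, insertionForm_apply]
    refine firstOrderDefect_comp
      (P := fun c => A (Fin.cons c fun j : Fin m => x (σ ⟨l + 1 + j, by omega⟩ - 1)))
      (fun c d => ?_) (fun c => ?_) (hA.cons _) (hB.cons _) f g
    · exact A.map_vecCons_add _ c d
    · have := A.map_vecCons_smul (fun j : Fin m => x (σ ⟨l + 1 + j, by omega⟩ - 1)) (-1 : k) c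
      rw [neg_one_smul, neg_one_smul] at this
      exact this
  · rw [firstOrderDefect_insertion_term_right h B hA x σ _, smul_zero]
    by_contra hlt
    refine h0 (?_ : σ 0 = 0)
    by_contra hne
    have hpos : 0 < ((σ.symm 0 : Fin (N + 1)) : ℕ) := Nat.pos_of_ne_zero fun hz =>
      hne ((congrArg σ (Fin.ext hz : σ.symm 0 = 0)).symm.trans (σ.apply_symm_apply 0))
    have := (Finset.mem_filter.1 hσ).2.1 0 (σ.symm 0) hpos (by omega)
    rw [Equiv.apply_symm_apply] at this
    exact absurd this (by simp)

/-- `ρ` fixes the first position and exchanges the following block of `m` positions with the block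
of `l` positions after it. -/
structure IsBlockSwap {N : ℕ} (l m : ℕ) (h : l + m = N) (ρ : Equiv.Perm (Fin (N + 1))) : Prop where
  zero : ρ 0 = 0
  left : ∀ i : Fin m, ρ ⟨1 + i, by omega⟩ = ⟨l + 1 + i, by omega⟩
  right : ∀ j : Fin l, ρ ⟨m + 1 + j, by omega⟩ = ⟨1 + j, by omega⟩

lemma IsBlockSwap.inv {N l m : ℕ} {h : l + m = N} {ρ : Equiv.Perm (Fin (N + 1))}
    (hρ : IsBlockSwap l m h ρ) : IsBlockSwap m l (by omega) ρ⁻¹ where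
  zero := Equiv.Perm.inv_eq_iff_eq.2 hρ.zero.symm
  left i := Equiv.Perm.inv_eq_iff_eq.2 (hρ.right i).symm
  right j := Equiv.Perm.inv_eq_iff_eq.2 (hρ.left j).symm

lemma IsBlockSwap.mul_mem {N l m : ℕ} {h : l + m = N} {ρ σ : Equiv.Perm (Fin (N + 1))}
    (hρ : IsBlockSwap l m h ρ) (hσ : σ ∈ pointedUnshuffles N (l + 1)) :
    σ * ρ ∈ pointedUnshuffles N (m + 1) := by
  simp only [pointedUnshuffles, Unshuffles, Finset.mem_filter, Finset.mem_univ, true_and] at hσ ⊢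
  obtain ⟨⟨h₁, h₂⟩, h0⟩ := hσ
  have h0' : (σ * ρ) 0 = 0 := by rw [Equiv.Perm.mul_apply, hρ.zero, h0]
  have hleft : ∀ i : Fin (N + 1), 0 < (i : ℕ) → (i : ℕ) < m + 1 →
      ∃ hlt, ρ i = ⟨l + i, hlt⟩ := by
    intro i hi hi'
    have := hρ.left ⟨i - 1, by omega⟩
    refine ⟨by omega, Eq.trans ?_ (this.trans ?_)⟩
    · congr 1; ext; simp; omega
    · ext; simp; omega
  have hright : ∀ i : Fin (N + 1), m + 1 ≤ (i : ℕ) → ∃ hlt, ρ i = ⟨i - m, hlt⟩ := by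
    intro i hi
    have := hρ.right ⟨i - (m + 1), by omega⟩
    refine ⟨by omega, Eq.trans ?_ (this.trans ?_)⟩
    · congr 1; ext; simp; omega
    · ext; simp; omega
  refine ⟨⟨fun i j hij hj => ?_, fun i j hij hi => ?_⟩, h0'⟩
  · rcases Nat.eq_zero_or_pos (i : ℕ) with hi | hi
    · obtain rfl : i = 0 := Fin.ext hi
      rw [h0']
      refine Fin.pos_iff_ne_zero.2 fun hz => ?_
      have := congrArg Fin.val ((σ * ρ).injective (hz.trans h0'.symm))
      omega
    · obtain ⟨_, ei⟩ := hleft i hi (by omega)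
      obtain ⟨_, ej⟩ := hleft j (by omega) hj
      rw [Equiv.Perm.mul_apply, Equiv.Perm.mul_apply, ei, ej]
      exact h₂ _ _ (by simpa using hij) (by simp; omega)
  · obtain ⟨_, ei⟩ := hright i hi
    obtain ⟨_, ej⟩ := hright j (by omega)
    rw [Equiv.Perm.mul_apply, Equiv.Perm.mul_apply, ei, ej]
    exact h₁ _ _ (by simp; omega) (by simp; omega)

lemma finRotate_pow_val {N : ℕ} (l : ℕ) (i : Fin N) :
    (((finRotate N ^ l) i : Fin N) : ℕ) = (i + l) % N := by
  obtain ⟨n, rfl⟩ : ∃ n, N = n + 1 := ⟨N - 1, by have := i.2; omega⟩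
  induction l with
  | zero => simp [Nat.mod_eq_of_lt i.2]
  | succ l ih =>
    rw [pow_succ', Equiv.Perm.mul_apply, finRotate_apply, Fin.val_add, ih]
    simp only [Fin.coe_ofNat_eq_mod, Nat.mod_add_mod, Nat.add_mod_mod, add_assoc]

lemma exists_isBlockSwap {N l m : ℕ} (h : l + m = N) :
    ∃ ρ : Equiv.Perm (Fin (N + 1)), IsBlockSwap l m h ρ ∧
      Equiv.Perm.sign ρ = (-1) ^ (m * l) := by
  have hval : ∀ (i : ℕ) (hi : i < N),
      Equiv.Perm.decomposeFin.symm (0, finRotate N ^ l) ⟨1 + i, by omega⟩ =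
        ⟨1 + (i + l) % N, by have := Nat.mod_lt (i + l) (show 0 < N by omega); omega⟩ := by
    intro i hi
    have : (⟨1 + i, by omega⟩ : Fin (N + 1)) = Fin.succ ⟨i, hi⟩ := by ext; simp [add_comm]
    rw [this, Equiv.Perm.decomposeFin_symm_apply_succ]
    ext
    simp [finRotate_pow_val, add_comm]
  refine ⟨Equiv.Perm.decomposeFin.symm (0, finRotate N ^ l), ⟨by simp, fun i => ?_, fun j => ?_⟩, ?_⟩
  · rw [hval i (by omega)]
    ext
    simp only [Nat.mod_eq_of_lt (show (i : ℕ) + l < N by omega)]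
    omega
  · have := hval (m + j) (by omega)
    simp only [show (m : ℕ) + j + l = j + N by omega, Nat.add_mod_right,
      Nat.mod_eq_of_lt (show (j : ℕ) < N by omega)] at this
    rw [← this]
    congr 1
    ext
    simp; omega
  · subst h
    rw [Equiv.Perm.decomposeFin.symm_sign, if_pos rfl, one_mul, map_pow, sign_finRotate, ← pow_mul]
    rcases l with _ | l
    · simp
    · rw [show l + 1 + m - 1 = l + m by omega, add_mul, pow_add,
        (Nat.even_mul_succ_self l).neg_one_pow, one_mul]

lemma firstOrderDefect_insertion_swap {m l N : ℕ} (h : l + 1 + m = N + 1) (h' : m + 1 + l = N + 1)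
    {A : V [⋀^Fin (m + 1)]→ₗ[k] V} {B : V [⋀^Fin (l + 1)]→ₗ[k] V} (hA : IsFirstOrder A)
    (hB : IsFirstOrder B) (x : ℕ → V) (f g : V) :
    firstOrderDefect (fun v => shuffleSum (N + 1) (m + 1) l h' (insertionForm B A) (consV v x)) f g =
      (((-1 : ℤˣ) ^ (m * l) : ℤˣ) : ℤ) • firstOrderDefect
        (fun v => shuffleSum (N + 1) (l + 1) m h (insertionForm A B) (consV v x)) f g := by
  obtain ⟨ρ, hρ, hsign⟩ := exists_isBlockSwap (show l + m = N by omega)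
  rw [firstOrderDefect_insertion h hA hB, firstOrderDefect_insertion h' hB hA, Finset.smul_sum]
  symm
  refine Finset.sum_equiv (Equiv.mulRight ρ) (fun σ => ⟨hρ.mul_mem, fun hσ => ?_⟩) fun σ _ => ?_
  · simpa using hρ.inv.mul_mem hσ
  · simp only [Equiv.coe_mulRight, Equiv.Perm.mul_apply, hρ.left, hρ.right, Equiv.Perm.sign_mul,
      hsign, Units.val_mul, smul_smul, derivationCross]
    rw [mul_comm (((-1 : ℤˣ) ^ (m * l) : ℤˣ) : ℤ)]
    congr 1
    ring

lemma firstOrderDefect_nrBracket {p q N : ℕ} (h : p + q = N + 2) {A B : Op V}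
    {A' : V [⋀^Fin p]→ₗ[k] V} {B' : V [⋀^Fin q]→ₗ[k] V}
    (hA : ∀ x : ℕ → V, A x = A' fun i => x i) (hB : ∀ x : ℕ → V, B x = B' fun i => x i)
    (hA' : IsFirstOrder A') (hB' : IsFirstOrder B') (x : ℕ → V) (f g : V) :
    firstOrderDefect (fun v => nrBracket ((p : ℤ) - 1) ((q : ℤ) - 1) A B (consV v x)) f g = 0 := by
  set s : ℤ := (((-1 : ℤˣ) ^ (((p : ℤ) - 1) * ((q : ℤ) - 1)) : ℤˣ) : ℤ) with hs
  have hsplit : firstOrderDefect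
      (fun v => nrBracket ((p : ℤ) - 1) ((q : ℤ) - 1) A B (consV v x)) f g =
      -firstOrderDefect (fun v => nrIns q p B A (consV v x)) f g +
        s • firstOrderDefect (fun v => nrIns p q A B (consV v x)) f g := by
    have happly : ∀ y, nrBracket ((p : ℤ) - 1) ((q : ℤ) - 1) A B y =
        -nrIns q p B A y + s • nrIns p q A B y := fun y => by
      simp only [nrBracket, ar_natCast_sub_one, Pi.add_apply, Pi.neg_apply, Pi.smul_apply, ← hs]
    simp only [firstOrderDefect, happly, zsmul_eq_mul]
    ring
  rw [hsplit]
  have hzero : ∀ (r : ℕ) (C D : Op V),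
      firstOrderDefect (fun v => nrIns 0 r C D (consV v x)) f g = 0 := by
    simp [nrIns, firstOrderDefect]
  rcases p with _ | m <;> rcases q with _ | l
  · omega
  · rw [hzero, nrIns_eq_shuffleSum (show 0 + l = N + 1 by omega) hB hA,
      firstOrderDefect_insertion_const _ _ hB']
    simp
  · rw [hzero, nrIns_eq_shuffleSum (show 0 + m = N + 1 by omega) hA hB,
      firstOrderDefect_insertion_const _ _ hA']
    simp
  · rw [nrIns_eq_shuffleSum (show m + 1 + l = N + 1 by omega) hB hA,
      nrIns_eq_shuffleSum (show l + 1 + m = N + 1 by omega) hA hB,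
      firstOrderDefect_insertion_swap (show l + 1 + m = N + 1 by omega) _ hA' hB']
    have : s = (((-1 : ℤˣ) ^ (m * l) : ℤˣ) : ℤ) := by
      rw [hs]
      congr 1
      rw [← zpow_natCast]
      congr 1
      push_cast
      ring
    rw [this, neg_add_cancel]

end FirstOrder

/-- The first-order multidifferential operators form a graded
associative subalgebra of `(A(V),∧)` and a graded Lie subalgebra of
`(A(V),[·,·]^{NR})`. -/
theorem statement5 (k V : Type*) [Field k] [CharZero k]
    [CommRing V] [Algebra k V]
    (a b : ℤ) (ha : -1 ≤ a) (hb : -1 ≤ b)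
    (A B : Op V) (hA : MemADiff1 k a A) (hB : MemADiff1 k b B) :
    MemADiff1 k (a + b + 1) (wedge (ar a) (ar b) A B) ∧
    MemADiff1 k (a + b) (nrBracket a b A B) := by
  obtain ⟨p, rfl⟩ : ∃ p : ℕ, a = (p : ℤ) - 1 := ⟨(a + 1).toNat, by omega⟩
  obtain ⟨q, rfl⟩ : ∃ q : ℕ, b = (q : ℤ) - 1 := ⟨(b + 1).toNat, by omega⟩
  obtain ⟨A', hA, hA'⟩ := hA.exists_alternatingMap
  obtain ⟨B', hB, hB'⟩ := hB.exists_alternatingMap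
  refine ⟨?_, ?_⟩
  · have har : ar ((p : ℤ) - 1 + (q - 1) + 1) = p + q := by rw [ar]; omega
    rw [MemADiff1, har, ar_natCast_sub_one, ar_natCast_sub_one, wedge_eq_shuffleSum hA hB]
    refine ⟨shuffleSum_multilinear .., shuffleSum_alternating _ _ _ _ _, fun hpos f g x => ?_⟩
    obtain ⟨N, hN⟩ : ∃ N, p + q = N + 1 := ⟨p + q - 1, by omega⟩
    have := firstOrderDefect_wedge hN hA' hB' x f g
    have hcast : shuffleSum (p + q) p q rfl (wedgeForm A' B') =
        shuffleSum (N + 1) p q hN (wedgeForm A' B') := by congr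
    rw [hcast]
    rw [firstOrderDefect] at this
    linear_combination this
  · have har : ar ((p : ℤ) - 1 + (q - 1)) = p + q - 1 := by rw [ar]; omega
    rw [MemADiff1, har]
    obtain ⟨hlin, halt⟩ := nrBracket_mem_alternating rfl hA hB
    refine ⟨hlin, halt, fun hpos f g x => ?_⟩
    have := firstOrderDefect_nrBracket (N := p + q - 2) (by omega) hA hB hA' hB' x f g
    rw [firstOrderDefect] at this
    linear_combination this


end JacobiRevisited
end
end

section
/- The multidifferential operators form a graded associative subalgebra of (A(V),∧) and a graded Lie subalgebra of (A(V),[·,·]^{NR}): if A ∈ ADiff^a(V) and B ∈ ADiff^b(V) (a,b ≥ −1), then A∧B ∈ ADiff^{a+b+1}(V) and [A,B]^{NR} ∈ ADiff^{a+b}(V). -/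
/-!  Common framework: operations of degree `a ≥ -1` on a vector space `V`
(i.e. `(a+1)`-linear maps `V^{a+1} → V`) are encoded as raw functions
`(ℕ → V) → V` depending only on the first `a+1` entries of the argument
sequence, together with explicit multilinearity/alternation predicates. -/

noncomputable section
open scoped Classical

namespace JacobiRevisited

open scoped TensorProduct

/-! ### Unshuffles as coset representatives -/

lemma Unshuffles.strictMono_left {p q : ℕ} {σ : Equiv.Perm (Fin (p + q))}
    (hσ : σ ∈ Unshuffles (p + q) p) : StrictMono fun i : Fin p => σ (Fin.castAdd q i) :=
  fun i j hij => (Finset.mem_filter.1 hσ).2.1 _ _ (by simpa using hij) (by simp)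

lemma Unshuffles.strictMono_right {p q : ℕ} {σ : Equiv.Perm (Fin (p + q))}
    (hσ : σ ∈ Unshuffles (p + q) p) : StrictMono fun i : Fin q => σ (Fin.natAdd p i) :=
  fun i j hij => (Finset.mem_filter.1 hσ).2.2 _ _ (by simpa using hij) (by simp)

lemma mem_unshuffles_of_strictMono {p q : ℕ} {σ : Equiv.Perm (Fin (p + q))}
    (hl : StrictMono fun i : Fin p => σ (Fin.castAdd q i))
    (hr : StrictMono fun i : Fin q => σ (Fin.natAdd p i)) : σ ∈ Unshuffles (p + q) p := by
  refine Finset.mem_filter.2 ⟨Finset.mem_univ _, fun i j hij hj => ?_, fun i j hij hi => ?_⟩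
  · exact @hl ⟨i, hij.trans hj⟩ ⟨j, hj⟩ hij
  · have h := @hr ⟨i - p, by omega⟩ ⟨j - p, by omega⟩ (by simp only [Fin.mk_lt_mk]; omega)
    have hi' : Fin.natAdd p ⟨i - p, by omega⟩ = i := Fin.ext (by simp; omega)
    have hj' : Fin.natAdd p ⟨j - p, by omega⟩ = j := Fin.ext (by simp; omega)
    simpa only [hi', hj'] using h

/-- A permutation of `Fin (p + q)`, regarded modulo permutations of the two blocks. -/
def blockClass (p q : ℕ) (σ : Equiv.Perm (Fin (p + q))) :
    Equiv.Perm.ModSumCongr (Fin p) (Fin q) :=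
  Quotient.mk'' (finSumFinEquiv.symm.permCongr σ)

lemma blockClass_injOn (p q : ℕ) :
    Set.InjOn (blockClass p q) (Unshuffles (p + q) p : Set (Equiv.Perm (Fin (p + q)))) := by
  intro σ hσ τ hτ h
  obtain ⟨⟨sl, sr⟩, hs⟩ := QuotientGroup.leftRel_apply.1 (Quotient.exact' h)
  replace hs := inv_mul_eq_iff_eq_mul.1 hs.symm
  have hl : (fun i => τ (Fin.castAdd q i)) = (fun i => σ (Fin.castAdd q i)) ∘ sl := by
    funext i
    have := Equiv.congr_fun hs (Sum.inl i)
    simpa [Equiv.Perm.sumCongrHom] using this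
  have hr : (fun i => τ (Fin.natAdd p i)) = (fun i => σ (Fin.natAdd p i)) ∘ sr := by
    funext i
    have := Equiv.congr_fun hs (Sum.inr i)
    simpa [Equiv.Perm.sumCongrHom] using this
  have hl' := ((Unshuffles.strictMono_left hσ).range_inj (Unshuffles.strictMono_left hτ)).1
    (by rw [hl, sl.surjective.range_comp])
  have hr' := ((Unshuffles.strictMono_right hσ).range_inj (Unshuffles.strictMono_right hτ)).1
    (by rw [hr, sr.surjective.range_comp])
  ext i : 1
  induction i using Fin.addCases with
  | left i => exact congrFun hl' i
  | right i => exact congrFun hr' i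

lemma exists_unshuffle_blockClass_eq {p q : ℕ} (c : Equiv.Perm.ModSumCongr (Fin p) (Fin q)) :
    ∃ σ ∈ Unshuffles (p + q) p, blockClass p q σ = c := by
  induction c using Quotient.inductionOn' with | _ τ
  let s : Finset (Fin (p + q)) :=
    Finset.univ.map (Function.Embedding.inl.trans (τ.trans finSumFinEquiv).toEmbedding)
  have hs : s.card = p := by simp [s]
  have hs' : sᶜ.card = q := by simp [Finset.card_compl, hs]
  let ρ : Equiv.Perm (Fin (p + q)) := finSumFinEquiv.symm.trans (finSumEquivOfFinset hs hs')
  have hl (i : Fin p) : ρ (Fin.castAdd q i) = s.orderEmbOfFin hs i := by simp [ρ]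
  have hr (i : Fin q) : ρ (Fin.natAdd p i) = sᶜ.orderEmbOfFin hs' i := by simp [ρ]
  refine ⟨ρ, mem_unshuffles_of_strictMono ?_ ?_, ?_⟩
  · simpa only [hl] using (s.orderEmbOfFin hs).strictMono
  · simpa only [hr] using (sᶜ.orderEmbOfFin hs').strictMono
  · refine Eq.symm (Quotient.sound' (QuotientGroup.leftRel_apply.2 ?_))
    apply Equiv.Perm.mem_sumCongrHom_range_of_perm_mapsTo_inl
    rintro _ ⟨i, rfl⟩
    obtain ⟨j, -, hj⟩ := Finset.mem_map.1 (s.orderEmbOfFin_mem hs i)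
    refine ⟨j, ?_⟩
    rw [Equiv.Perm.mul_apply, Equiv.Perm.eq_inv_iff_eq]
    simp only [Equiv.permCongr_apply, Equiv.symm_symm, finSumFinEquiv_apply_left, hl]
    rw [← hj]
    simp

lemma lift_domCoprod_summand_mk {k V N₁ N₂ N : Type*} [CommRing k] [AddCommGroup V]
    [Module k V] [AddCommGroup N₁] [Module k N₁] [AddCommGroup N₂] [Module k N₂]
    [AddCommGroup N] [Module k N] {p q : ℕ}
    (f : V [⋀^Fin p]→ₗ[k] N₁) (g : V [⋀^Fin q]→ₗ[k] N₂) (μ : N₁ →ₗ[k] N₂ →ₗ[k] N)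
    (τ : Equiv.Perm (Fin p ⊕ Fin q)) (y : Fin p ⊕ Fin q → V) :
    TensorProduct.lift μ (AlternatingMap.domCoprod.summand f g (Quotient.mk'' τ) y) =
      ((Equiv.Perm.sign τ : ℤˣ) : ℤ) •
        μ (f fun i => y (τ (Sum.inl i))) (g fun j => y (τ (Sum.inr j))) := by
  change TensorProduct.lift μ (Equiv.Perm.sign τ •
    (f (fun i => y (τ (Sum.inl i))) ⊗ₜ[k] g fun j => y (τ (Sum.inr j)))) = _
  rw [Units.smul_def, map_zsmul, TensorProduct.lift.tmul]

/-- A sum over unshuffles of a bilinear pairing of two alternating maps is alternating. -/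
lemma exists_alternatingMap_sum_unshuffles {k V N₁ N₂ N : Type*} [CommRing k] [AddCommGroup V]
    [Module k V] [AddCommGroup N₁] [Module k N₁] [AddCommGroup N₂] [Module k N₂]
    [AddCommGroup N] [Module k N] {n p q : ℕ} (h : n = p + q)
    (f : V [⋀^Fin p]→ₗ[k] N₁) (g : V [⋀^Fin q]→ₗ[k] N₂) (μ : N₁ →ₗ[k] N₂ →ₗ[k] N) :
    ∃ G : V [⋀^Fin n]→ₗ[k] N, ∀ x : Fin n → V,
      G x = ∑ σ ∈ Unshuffles n p, ((Equiv.Perm.sign σ : ℤˣ) : ℤ) •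
        μ (f fun i => x (σ ⟨i, by omega⟩)) (g fun j => x (σ ⟨p + j, by omega⟩)) := by
  subst h
  refine ⟨((TensorProduct.lift μ).compAlternatingMap (f.domCoprod g)).domDomCongr finSumFinEquiv,
    fun x => ?_⟩
  simp only [AlternatingMap.domDomCongr_apply, LinearMap.compAlternatingMap_apply,
    AlternatingMap.domCoprod_apply, _root_.sum_apply, map_sum]
  symm
  refine Finset.sum_bij (fun σ _ => blockClass p q σ) (fun _ _ => by simp)
    (fun σ hσ τ hτ h => blockClass_injOn p q hσ hτ h)
    (fun c _ => ?_) (fun σ _ => ?_)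
  · obtain ⟨σ, hσ, h⟩ := exists_unshuffle_blockClass_eq c
    exact ⟨σ, hσ, h⟩
  · rw [blockClass, lift_domCoprod_summand_mk, Equiv.Perm.sign_permCongr]
    simp only [Equiv.permCongr_apply, Equiv.symm_symm, finSumFinEquiv_apply_left,
      finSumFinEquiv_apply_right, Function.comp_apply, Equiv.apply_symm_apply]
    rfl

/-! ### Operations on sequences and alternating maps on `Fin n → V` -/

/-- Extension of a finite argument sequence by zero. -/
def zeroExtend {V : Type*} [Zero V] {n : ℕ} (v : Fin n → V) : ℕ → V := fun i =>
  if hi : i < n then v ⟨i, hi⟩ else 0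

lemma zeroExtend_update {V : Type*} [Zero V] {n : ℕ} (v : Fin n → V) (i : Fin n) (c : V) :
    zeroExtend (Function.update v i c) = Function.update (zeroExtend v) i c := by
  funext j
  by_cases hj : j = i
  · subst hj; simp [zeroExtend]
  · by_cases hn : j < n
    · have : (⟨j, hn⟩ : Fin n) ≠ i := fun h => hj (by rw [← h])
      simp [zeroExtend, hj, hn, this]
    · simp [zeroExtend, hj, hn]

lemma zeroExtend_vecCons {V : Type*} [Zero V] {q : ℕ} (w : V) (v : Fin q → V) :
    zeroExtend (Matrix.vecCons w v) = fun j => if hj₀ : j = 0 then w else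
      if hj : j < q + 1 then v ⟨j - 1, by omega⟩ else 0 := by
  funext j
  rcases j with _ | j
  · simp [zeroExtend]
  · by_cases hj : j < q
    · have : (⟨j + 1, by omega⟩ : Fin (q + 1)) = Fin.succ ⟨j, hj⟩ := rfl
      rw [zeroExtend, dif_pos (by omega), this]
      simp [hj]
    · simp [zeroExtend, hj]

lemma zeroExtend_vecCons_eq_update {V : Type*} [Zero V] {q : ℕ} (w : V) (v : Fin q → V) :
    zeroExtend (Matrix.vecCons w v) =
      Function.update (zeroExtend (Matrix.vecCons 0 v)) 0 w := by
  simp only [zeroExtend_vecCons]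
  funext j
  by_cases hj : j = 0 <;> simp [hj]

lemma zeroExtend_vecCons_update {V : Type*} [Zero V] {q : ℕ} (w : V) (v : Fin q → V)
    (j : Fin q) (c : V) : zeroExtend (Matrix.vecCons w (Function.update v j c)) =
      Function.update (zeroExtend (Matrix.vecCons w v)) (j + 1) c := by
  have : Matrix.vecCons w (Function.update v j c) =
      Function.update (Matrix.vecCons w v) j.succ c := Fin.cons_update ..
  rw [this, zeroExtend_update, Fin.val_succ]

/-- The alternating map on `Fin n → V` given by an alternating `n`-linear operation. -/
def toAlternatingMap {k V : Type*} [CommRing k] [AddCommGroup V] [Module k V] {n : ℕ} {A : Op V}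
    (hA : IsMultilinearOn k n A) (hA' : IsAlternatingOn n A) : V [⋀^Fin n]→ₗ[k] V where
  toFun v := A (zeroExtend v)
  map_update_add' {_} v i x y := by
    obtain rfl := Subsingleton.elim ‹DecidableEq (Fin n)› (instDecidableEqFin n)
    simp only [zeroExtend_update]
    exact (hA.2 i i.2).2 _ x y
  map_update_smul' {_} v i c x := by
    obtain rfl := Subsingleton.elim ‹DecidableEq (Fin n)› (instDecidableEqFin n)
    simp only [zeroExtend_update]
    exact (hA.2 i i.2).1 _ c x
  map_eq_zero_of_eq' v i j hv hij :=
    hA' _ i j i.2 j.2 (fun h => hij (Fin.ext h)) (by simpa [zeroExtend] using hv)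

lemma restrict_update {V : Type*} {n i : ℕ} (hi : i < n) (x : ℕ → V) (v : V) :
    (fun j : Fin n => Function.update x i v j) =
      Function.update (fun j : Fin n => x j) ⟨i, hi⟩ v := by
  funext j
  simp [Function.update_apply, Fin.ext_iff]

lemma isMultilinearOn_of_alternatingMap {k V : Type*} [CommRing k] [AddCommGroup V] [Module k V]
    {n : ℕ} {A : Op V} (G : V [⋀^Fin n]→ₗ[k] V) (h : ∀ x, A x = G fun i => x i) :
    IsMultilinearOn k n A := by
  refine ⟨fun x y hxy => ?_, fun i hi => ⟨fun x c v => ?_, fun x v w => ?_⟩⟩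
  · rw [h, h]
    exact congrArg G (funext fun i => hxy i i.2)
  · rw [h, h, restrict_update hi, restrict_update hi, G.map_update_smul]
  · rw [h, h, h, restrict_update hi, restrict_update hi, restrict_update hi, G.map_update_add]

lemma isAlternatingOn_of_alternatingMap {k V : Type*} [CommRing k] [AddCommGroup V] [Module k V]
    {n : ℕ} {A : Op V} (G : V [⋀^Fin n]→ₗ[k] V) (h : ∀ x, A x = G fun i => x i) :
    IsAlternatingOn n A := fun x i j hi hj hij hx => by
  rw [h]
  exact G.map_eq_zero_of_eq _ (i := ⟨i, hi⟩) (j := ⟨j, hj⟩) hx (by simpa using hij)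

/-- An alternating map in `q + 1` arguments, as an alternating map of the last `q` arguments
valued in linear endomorphisms. -/
def tailAlternatingMap {k V : Type*} [CommRing k] [AddCommGroup V] [Module k V] {q : ℕ}
    (f : V [⋀^Fin (q + 1)]→ₗ[k] V) : V [⋀^Fin q]→ₗ[k] (V →ₗ[k] V) where
  toFun v :=
    { toFun := fun w => f.curryLeft w v
      map_add' := fun w w' => by simp only [map_add, AlternatingMap.add_apply]
      map_smul' := fun c w => by simp only [map_smul, AlternatingMap.smul_apply, RingHom.id_apply] }
  map_update_add' v i x y := by
    ext w
    exact (f.curryLeft w).map_update_add v i x y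
  map_update_smul' v i c x := by
    ext w
    exact (f.curryLeft w).map_update_smul v i c x
  map_eq_zero_of_eq' v i j hv hij := by
    ext w
    exact (f.curryLeft w).map_eq_zero_of_eq v hv hij

/-! ### Differential operators of finite order -/

namespace DiffOrderLe

variable {V : Type*} [CommRing V]

lemma zero (n : ℕ) : DiffOrderLe n fun _ : V => (0 : V) := by
  induction n with
  | zero => intro f x; simp
  | succ n ih => intro f; simpa using ih

lemma add {n : ℕ} {D E : V → V} (hD : DiffOrderLe n D) (hE : DiffOrderLe n E) :
    DiffOrderLe n fun x => D x + E x := by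
  induction n generalizing D E with
  | zero => intro f x; simp only [hD f x, hE f x, mul_add]
  | succ n ih =>
    intro f
    convert! ih (hD f) (hE f) using 2
    ring

lemma mul_left {n : ℕ} {D : V → V} (c : V) (hD : DiffOrderLe n D) :
    DiffOrderLe n fun x => c * D x := by
  induction n generalizing D with
  | zero => intro f x; simp only [hD f x]; ring
  | succ n ih =>
    intro f
    convert! ih (hD f) using 2
    ring

lemma mul_right {n : ℕ} {D : V → V} (c : V) (hD : DiffOrderLe n D) :
    DiffOrderLe n fun x => D x * c := by
  simpa only [mul_comm] using hD.mul_left c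

lemma zsmul {n : ℕ} {D : V → V} (c : ℤ) (hD : DiffOrderLe n D) :
    DiffOrderLe n fun x => c • D x := by
  simpa only [zsmul_eq_mul] using hD.mul_left (c : V)

lemma succ {n : ℕ} {D : V → V} (hD : DiffOrderLe n D) : DiffOrderLe (n + 1) D := by
  induction n generalizing D with
  | zero => intro f g x; simp only [hD f]; simp
  | succ n ih => exact fun f => ih (hD f)

lemma mono {m n : ℕ} (h : m ≤ n) {D : V → V} (hD : DiffOrderLe m D) : DiffOrderLe n D := by
  induction n, h using Nat.le_induction with
  | base => exact hD
  | succ n _ ih => exact ih.succ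

lemma sum {ι : Type*} {n : ℕ} {D : ι → V → V} (s : Finset ι)
    (hD : ∀ i ∈ s, DiffOrderLe n (D i)) : DiffOrderLe n fun x => ∑ i ∈ s, D i x := by
  induction s using Finset.induction_on with
  | empty => simpa using zero n
  | insert i s hi ih =>
    simp only [Finset.sum_insert hi]
    exact (hD i (s.mem_insert_self i)).add (ih fun j hj => hD j (Finset.mem_insert_of_mem hj))

lemma comp {m n : ℕ} {D E : V → V} (hadd : ∀ u v, D (u + v) = D u + D v)
    (hD : DiffOrderLe m D) (hE : DiffOrderLe n E) : DiffOrderLe (m + n) fun x => D (E x) := by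
  induction m generalizing D E n with
  | zero =>
    rw [Nat.zero_add]
    induction n generalizing E with
    | zero => intro f x; simp only [hE f x, hD f (E x)]
    | succ n ih =>
      intro f
      convert! ih (hE f) using 2 with x
      have := hadd (E (f * x) - f * E x) (f * E x)
      rw [sub_add_cancel, hD f (E x)] at this
      simp only [this, add_sub_cancel_right]
  | succ m ihm =>
    have hadd' (f u v : V) : D (f * (u + v)) - f * D (u + v) =
        D (f * u) - f * D u + (D (f * v) - f * D v) := by
      rw [mul_add, hadd, hadd]; ring
    induction n generalizing E with
    | zero =>
      intro f
      convert! ihm (hadd' f) (hD f) hE using 2 with x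
      simp only [hE f x]
    | succ n ihn =>
      intro f
      have h₁ := (ihm (hadd' f) (hD f) hE).mono (n := m + 1 + n) (by omega)
      have h₂ := ihn (hE f)
      convert! h₁.add h₂ using 1
      funext x
      have := hadd (E (f * x) - f * E x) (f * E x)
      rw [sub_add_cancel] at this
      simp only [this]
      ring

end DiffOrderLe

/-- `A` is a differential operator of finite order in the `i`-th argument, uniformly in the
other arguments. -/
def IsDiffAt {V : Type*} [CommRing V] (i : ℕ) (A : Op V) : Prop :=
  ∃ n, ∀ x : ℕ → V, DiffOrderLe n fun v => A (Function.update x i v)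

namespace IsDiffAt

variable {V : Type*} [CommRing V] {i : ℕ}

lemma zsmul {A : Op V} (c : ℤ) (hA : IsDiffAt i A) : IsDiffAt i (c • A) :=
  hA.imp fun _ h x => (h x).zsmul c

lemma neg {A : Op V} (hA : IsDiffAt i A) : IsDiffAt i (-A) := by
  simpa using hA.zsmul (-1)

lemma sum {ι : Type*} {A : ι → Op V} (s : Finset ι) (hA : ∀ j ∈ s, IsDiffAt i (A j)) :
    IsDiffAt i fun x => ∑ j ∈ s, A j x := by
  choose! n hn using hA
  exact ⟨s.sup n, fun x => DiffOrderLe.sum s fun j hj => (hn j hj x).mono (Finset.le_sup hj)⟩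

lemma add {A B : Op V} (hA : IsDiffAt i A) (hB : IsDiffAt i B) : IsDiffAt i (A + B) := by
  obtain ⟨m, hm⟩ := hA
  obtain ⟨n, hn⟩ := hB
  exact ⟨max m n, fun x => ((hm x).mono (le_max_left _ _)).add ((hn x).mono (le_max_right _ _))⟩

end IsDiffAt

namespace IsMultilinearOn

variable {k V : Type*} [CommRing k] [AddCommGroup V] [Module k V] {n : ℕ} {A B : Op V}

lemma add (hA : IsMultilinearOn k n A) (hB : IsMultilinearOn k n B) :
    IsMultilinearOn k n (A + B) := by
  refine ⟨fun x y h => ?_, fun i hi => ⟨fun x c v => ?_, fun x v w => ?_⟩⟩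
  · simp only [Pi.add_apply, hA.1 x y h, hB.1 x y h]
  · simp only [Pi.add_apply, (hA.2 i hi).1, (hB.2 i hi).1, smul_add]
  · simp only [Pi.add_apply, (hA.2 i hi).2, (hB.2 i hi).2]
    abel

lemma zsmul (c : ℤ) (hA : IsMultilinearOn k n A) : IsMultilinearOn k n (c • A) := by
  refine ⟨fun x y h => ?_, fun i hi => ⟨fun x d v => ?_, fun x v w => ?_⟩⟩
  · simp only [Pi.smul_apply, hA.1 x y h]
  · simp only [Pi.smul_apply, (hA.2 i hi).1]
    exact smul_comm _ _ _
  · simp only [Pi.smul_apply, (hA.2 i hi).2, smul_add]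

end IsMultilinearOn

/-- `A` is an alternating multidifferential operator in its first `n` arguments. -/
def IsMultiDiffOn (k : Type*) {V : Type*} [CommRing k] [CommRing V] [Algebra k V]
    (n : ℕ) (A : Op V) : Prop :=
  IsMultilinearOn k n A ∧ IsAlternatingOn n A ∧ ∀ i, i < n → IsDiffAt i A

namespace IsMultiDiffOn

variable {k V : Type*} [CommRing k] [CommRing V] [Algebra k V] {A B : Op V}

lemma zsmul {n : ℕ} (c : ℤ) (hA : IsMultiDiffOn k n A) : IsMultiDiffOn k n (c • A) :=
  ⟨hA.1.zsmul c,
    fun x i j hi hj hij hx => by simp [hA.2.1 x i j hi hj hij hx],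
    fun i hi => (hA.2.2 i hi).zsmul c⟩

lemma neg {n : ℕ} (hA : IsMultiDiffOn k n A) : IsMultiDiffOn k n (-A) := by
  simpa using hA.zsmul (-1)

lemma add {n : ℕ} (hA : IsMultiDiffOn k n A) (hB : IsMultiDiffOn k n B) :
    IsMultiDiffOn k n (A + B) :=
  ⟨hA.1.add hB.1,
    fun x i j hi hj hij hx => by
      simp [hA.2.1 x i j hi hj hij hx, hB.2.1 x i j hi hj hij hx],
    fun i hi => (hA.2.2 i hi).add (hB.2.2 i hi)⟩

lemma zero (n : ℕ) : IsMultiDiffOn k n (0 : Op V) :=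
  ⟨⟨fun _ _ _ => rfl, fun _ _ => ⟨fun _ _ _ => by simp, fun _ _ _ => by simp⟩⟩,
    fun _ _ _ _ _ _ _ => rfl, fun _ _ => ⟨0, fun _ => DiffOrderLe.zero 0⟩⟩

end IsMultiDiffOn

section Products

variable {k V : Type*} [CommRing k] [CommRing V] [Algebra k V] {A B : Op V}

/-- The general term of a sum over unshuffles, as a function of the two blocks of arguments, is a
differential operator in each argument as soon as it is one in each argument of each block. -/
lemma isDiffAt_blocks {n p q : ℕ} (hn : n = p + q) (σ : Equiv.Perm (Fin n))
    (T : (Fin p → V) → (Fin q → V) → V)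
    (hl : ∀ j, ∃ m, ∀ y z, DiffOrderLe m fun v => T (Function.update y j v) z)
    (hr : ∀ j, ∃ m, ∀ y z, DiffOrderLe m fun v => T y (Function.update z j v))
    {i : ℕ} (hi : i < n) :
    IsDiffAt i fun x : ℕ → V =>
      T (fun l => x (σ ⟨l, by omega⟩)) (fun l => x (σ ⟨p + l, by omega⟩)) := by
  obtain ⟨⟨j, hj⟩, hji⟩ := σ.surjective ⟨i, hi⟩
  obtain rfl : (σ ⟨j, hj⟩ : ℕ) = i := by rw [hji]
  clear hji
  have hne (l : ℕ) (hl : l < n) (h : l ≠ j) (x : ℕ → V) (v : V) :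
      Function.update x (σ ⟨j, hj⟩) v (σ ⟨l, hl⟩) = x (σ ⟨l, hl⟩) :=
    Function.update_of_ne (by simpa [← Fin.ext_iff] using h) _ _
  rcases lt_or_ge j p with hjp | hjp
  · obtain ⟨m, hm⟩ := hl ⟨j, hjp⟩
    refine ⟨m, fun x => ?_⟩
    convert! hm (fun l => x (σ ⟨l, by omega⟩)) (fun l => x (σ ⟨p + l, by omega⟩)) using 3 with v
    · funext l
      by_cases h : l = ⟨j, hjp⟩
      · subst h; simp
      · rw [Function.update_of_ne h, hne _ _ (by simpa [Fin.ext_iff] using h)]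
    · funext l
      rw [hne _ _ (by omega)]
  · obtain ⟨l₀, rfl⟩ := Nat.exists_eq_add_of_le hjp
    obtain ⟨m, hm⟩ := hr ⟨l₀, by omega⟩
    refine ⟨m, fun x => ?_⟩
    convert! hm (fun l => x (σ ⟨l, by omega⟩)) (fun l => x (σ ⟨p + l, by omega⟩)) using 3 with v
    · funext l
      rw [hne _ _ (by omega)]
    · funext l
      by_cases h : l = ⟨l₀, by omega⟩
      · subst h; simp
      · rw [Function.update_of_ne h, hne _ _ (by simpa [Fin.ext_iff] using h)]

lemma wedge_eq_sum (p q : ℕ) (x : ℕ → V) :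
    wedge p q A B x = ∑ σ ∈ Unshuffles (p + q) p, ((Equiv.Perm.sign σ : ℤˣ) : ℤ) •
      (A (zeroExtend fun i : Fin p => x (σ ⟨i, by omega⟩)) *
        B (zeroExtend fun j : Fin q => x (σ ⟨p + j, by omega⟩))) := rfl

lemma nrIns_eq_sum {q p n : ℕ} (hn : n = p + q) (x : ℕ → V) :
    nrIns (q + 1) p A B x = ∑ σ ∈ Unshuffles n p, ((Equiv.Perm.sign σ : ℤˣ) : ℤ) •
      A (zeroExtend (Matrix.vecCons (B (zeroExtend fun i : Fin p => x (σ ⟨i, by omega⟩)))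
        fun j : Fin q => x (σ ⟨p + j, by omega⟩))) := by
  obtain rfl : n = q + 1 + p - 1 := by omega
  rw [nrIns, dif_neg q.succ_ne_zero]
  refine Finset.sum_congr rfl fun σ _ => ?_
  rw [zeroExtend_vecCons]
  congr 2
  funext j
  split_ifs with h₀ hj
  · rfl
  · exact congrArg (fun l => x (σ l)) (Fin.ext (by simp only; omega))
  · rfl

/-- The wedge product of alternating multidifferential operators is one. -/
lemma IsMultiDiffOn.wedge {p q : ℕ} (hA : IsMultiDiffOn k p A) (hB : IsMultiDiffOn k q B) :
    IsMultiDiffOn k (p + q) (wedge p q A B) := by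
  obtain ⟨G, hG⟩ := exists_alternatingMap_sum_unshuffles rfl (toAlternatingMap hA.1 hA.2.1)
    (toAlternatingMap hB.1 hB.2.1) (LinearMap.mul k V)
  have h (x : ℕ → V) : JacobiRevisited.wedge p q A B x = G fun i => x i := by
    rw [hG]
    rfl
  refine ⟨isMultilinearOn_of_alternatingMap G h, isAlternatingOn_of_alternatingMap G h,
    fun i hi => ?_⟩
  rw [funext (wedge_eq_sum (A := A) (B := B) p q)]
  refine IsDiffAt.sum _ fun σ _ => IsDiffAt.zsmul _ <|
    isDiffAt_blocks rfl σ (fun y z => A (zeroExtend y) * B (zeroExtend z))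
      (fun j => (hA.2.2 j j.2).imp fun m hm y z => ?_)
      (fun j => (hB.2.2 j j.2).imp fun m hm y z => ?_) hi
  · simp only [zeroExtend_update]
    exact (hm _).mul_right _
  · simp only [zeroExtend_update]
    exact (hm _).mul_left _

/-- The Nijenhuis–Richardson insertion of an alternating multidifferential operator into
another is one. -/
lemma IsMultiDiffOn.nrIns {p q : ℕ} (hA : IsMultiDiffOn k q A) (hB : IsMultiDiffOn k p B) :
    IsMultiDiffOn k (q + p - 1) (nrIns q p A B) := by
  rcases q with _ | q
  · have : JacobiRevisited.nrIns 0 p A B = 0 := by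
      funext x
      simp [JacobiRevisited.nrIns]
    rw [this]
    exact .zero _
  have hn : q + 1 + p - 1 = p + q := by omega
  rw [hn]
  obtain ⟨G, hG⟩ := exists_alternatingMap_sum_unshuffles rfl (toAlternatingMap hB.1 hB.2.1)
    (tailAlternatingMap (toAlternatingMap hA.1 hA.2.1)) (LinearMap.id.flip)
  have h (x : ℕ → V) : JacobiRevisited.nrIns (q + 1) p A B x = G fun i => x i := by
    rw [hG, nrIns_eq_sum rfl]
    rfl
  refine ⟨isMultilinearOn_of_alternatingMap G h, isAlternatingOn_of_alternatingMap G h,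
    fun i hi => ?_⟩
  rw [funext (nrIns_eq_sum (A := A) (B := B) rfl)]
  refine IsDiffAt.sum _ fun σ _ => IsDiffAt.zsmul _ <|
    isDiffAt_blocks rfl σ (fun y z => A (zeroExtend (Matrix.vecCons (B (zeroExtend y)) z)))
      (fun j => ?_) (fun j => (hA.2.2 (j + 1) (by omega)).imp fun m hm y z => ?_) hi
  · obtain ⟨m, hm⟩ := hA.2.2 0 (by omega)
    obtain ⟨m', hm'⟩ := hB.2.2 j j.2
    refine ⟨m + m', fun y z => ?_⟩
    simp only [zeroExtend_update, zeroExtend_vecCons_eq_update (B _) z]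
    exact (hm (zeroExtend (Matrix.vecCons 0 z))).comp ((hA.1.2 0 (by omega)).2 _) (hm' _)
  · simp only [zeroExtend_vecCons_update]
    exact hm _

end Products

/-- The multidifferential operators form a graded associative
subalgebra of `(A(V),∧)` and a graded Lie subalgebra of
`(A(V),[·,·]^{NR})`. -/
theorem statement6 (k V : Type*) [Field k] [CharZero k]
    [CommRing V] [Algebra k V]
    (a b : ℤ) (ha : -1 ≤ a) (hb : -1 ≤ b)
    (A B : Op V) (hA : MemADiff k a A) (hB : MemADiff k b B) :
    MemADiff k (a + b + 1) (wedge (ar a) (ar b) A B) ∧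
    MemADiff k (a + b) (nrBracket a b A B) := by
  have hA' : IsMultiDiffOn k (ar a) A := hA
  have hB' : IsMultiDiffOn k (ar b) B := hB
  have h₁ : ar (a + b + 1) = ar a + ar b := by simp only [ar]; omega
  have h₂ : ar (a + b) = ar a + ar b - 1 := by simp only [ar]; omega
  have h₃ : ar (a + b) = ar b + ar a - 1 := by simp only [ar]; omega
  refine ⟨?_, ?_⟩
  · change IsMultiDiffOn k (ar (a + b + 1)) _
    rw [h₁]
    exact hA'.wedge hB'
  · change IsMultiDiffOn k (ar (a + b)) (-_ + _ • _)
    refine (IsMultiDiffOn.neg ?_).add (IsMultiDiffOn.zsmul _ ?_)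
    · rw [h₃]
      exact hB'.nrIns hA'
    · rw [h₂]
      exact hA'.nrIns hB'

end JacobiRevisited
end
end
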